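/- arXiv:1502.00776 — 10 statements merged into one kernel-verified Lean document; each statement's English description precedes it below -/
import Mathlib

section
/- For every integer k ≥ 1, the projective cube of dimension 2k, PC_{2k}, has odd-girth 2k+1; that is, PC_{2k} contains a cycle of length 2k+1 and contains no odd cycle of length less than 2k+1. -/
open SimpleGraph

/-- The Cayley graph of the binary group `(ℤ/2ℤ)^n` with connection set `Ω`:
vertices are the vectors, and `u ~ v` iff `u ≠ v` and `u + v ∈ Ω`. -/
def binCayley {n : ℕ} (Ω : Set (Fin n → ZMod 2)) : SimpleGraph (Fin n → ZMod 2) :=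
  SimpleGraph.fromRel (fun u v => u + v ∈ Ω)

/-- The projective cube of dimension `d`: the Cayley graph of `(ℤ/2ℤ)^d` whose
connection set consists of the standard basis vectors together with the all-ones vector. -/
def projCube (d : ℕ) : SimpleGraph (Fin d → ZMod 2) :=
  binCayley ({x | ∃ i, x = Pi.single i 1} ∪ {x | x = fun _ => 1})

theorem projCube_adj {d : ℕ} {u v : Fin d → ZMod 2} :
    (projCube d).Adj u v ↔ u ≠ v ∧ ((∃ i, u + v = Pi.single i 1) ∨ u + v = fun _ => 1) := by
  simp [projCube, binCayley, add_comm v u, or_comm]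

/-- A walk in the projective cube uses each basis direction `i` some number `c i` of times and the
all-ones direction `m` times; these numbers add up to its length and determine `u + v`. -/
theorem exists_direction_counts {d : ℕ} {u v : Fin d → ZMod 2} (w : (projCube d).Walk u v) :
    ∃ (c : Fin d → ℕ) (m : ℕ), w.length = ∑ i, c i + m ∧
      ∀ i, u i + v i = ((c i + m : ℕ) : ZMod 2) := by
  induction w with
  | nil => exact ⟨0, 0, by simp, fun i => by simp [CharTwo.add_self_eq_zero]⟩
  | @cons a b e h p ih =>
    obtain ⟨c, m, hlen, hc⟩ := ih
    have split : ∀ i, a i + e i = (a + b) i + (b i + e i) := fun i => by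
      rw [Pi.add_apply, ← add_assoc, add_assoc (a i), CharTwo.add_self_eq_zero, add_zero]
    rcases (projCube_adj.1 h).2 with ⟨j, hj⟩ | hj
    · refine ⟨c + Pi.single j 1, m, ?_, fun i => ?_⟩
      · simp [Finset.sum_add_distrib, hlen]
        ring
      · rw [split, hj, hc]
        by_cases hij : i = j
        · subst hij
          simp
          ring
        · simp [hij]
    · refine ⟨c, m + 1, ?_, fun i => ?_⟩
      · simp [hlen, add_assoc]
      · rw [split, hj, hc]
        push_cast
        ring

theorem lt_length_of_odd {d : ℕ} {u : Fin d → ZMod 2} (w : (projCube d).Walk u u)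
    (hodd : Odd w.length) : d < w.length := by
  obtain ⟨c, m, hlen, hc⟩ := exists_direction_counts w
  have heven : ∀ i, Even (c i + m) := fun i => by
    rw [← ZMod.natCast_eq_zero_iff_even, ← hc i, CharTwo.add_self_eq_zero]
  rcases Nat.even_or_odd m with hm | hm
  · have hsum : Even (∑ i, c i) :=
      Finset.even_sum _ fun i _ => (Nat.even_add.1 (heven i)).2 hm
    exact absurd (hlen ▸ hsum.add hm) (Nat.not_even_iff_odd.2 hodd)
  · have hpos : ∀ i, 1 ≤ c i := fun i => by
      have := heven i
      grind
    have hsum : ∑ _i : Fin d, 1 ≤ ∑ i, c i := Finset.sum_le_sum fun i _ => hpos i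
    have := hm.pos
    simp at hsum
    omega

/-- The indicator vector of the first `j` coordinates. -/
def initialOnes (d j : ℕ) : Fin d → ZMod 2 := fun i => if (i : ℕ) < j then 1 else 0

theorem initialOnes_injOn {d : ℕ} {a b : ℕ} (ha : a ≤ d) (hb : b ≤ d)
    (h : initialOnes d a = initialOnes d b) : a = b := by
  wlog hab : a < b generalizing a b
  · by_contra hne
    exact hne (this hb ha h.symm (by omega)).symm
  · have := congrFun h ⟨a, by omega⟩
    simp [initialOnes, hab] at this

theorem projCube_adj_initialOnes_succ {d j : ℕ} (hj : j < d) :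
    (projCube d).Adj (initialOnes d j) (initialOnes d (j + 1)) := by
  refine projCube_adj.2 ⟨fun h => ?_, Or.inl ⟨⟨j, hj⟩, ?_⟩⟩
  · have := initialOnes_injOn (by omega) (by omega) h
    omega
  · ext i
    rcases lt_trichotomy (i : ℕ) j with h | h | h
    · have hne : i ≠ ⟨j, hj⟩ := fun e => by simp [e] at h
      simp [initialOnes, h, hne, Nat.lt_succ_of_lt h, CharTwo.add_self_eq_zero]
    · have he : i = ⟨j, hj⟩ := Fin.ext h
      simp [initialOnes, he]
    · have hne : i ≠ ⟨j, hj⟩ := fun e => by simp [e] at h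
      simp [initialOnes, hne, h.not_gt, (Nat.succ_le_of_lt h).not_gt]

theorem projCube_adj_initialOnes_zero {d : ℕ} (hd : 0 < d) :
    (projCube d).Adj (initialOnes d d) (initialOnes d 0) := by
  refine projCube_adj.2 ⟨fun h => ?_, Or.inr ?_⟩
  · have := initialOnes_injOn le_rfl (by omega) h
    omega
  · ext i
    simp [initialOnes]

theorem cycleGraph_isContained_projCube {d : ℕ} (hd : 0 < d) :
    cycleGraph (d + 1) ⊑ projCube d := by
  have step : ∀ a b : Fin (d + 1), (a - b).val = 1 →
      (projCube d).Adj (initialOnes d b) (initialOnes d a) := fun a b h => by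
    rcases le_or_gt b a with hba | hba
    · rw [Fin.sub_val_of_le hba] at h
      rw [show (a : ℕ) = b + 1 by omega]
      exact projCube_adj_initialOnes_succ (by omega)
    · rw [Fin.coe_sub_iff_lt.2 hba] at h
      rw [show (a : ℕ) = 0 by omega, show (b : ℕ) = d by omega]
      exact projCube_adj_initialOnes_zero hd
  refine ⟨⟨⟨fun j => initialOnes d j, fun {a b} h => ?_⟩, fun a b h => ?_⟩⟩
  · rcases cycleGraph_adj'.1 h with h | h
    · exact (step a b h).symm
    · exact step b a h
  · exact Fin.ext (initialOnes_injOn (by omega) (by omega) h)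

/-- For every `k ≥ 1`, the projective cube `PC_{2k}` has odd-girth `2k+1`:
it contains a cycle of length `2k+1`, and every odd cycle has length at least `2k+1`. -/
theorem projCube_even_dim_oddGirth (k : ℕ) (hk : 1 ≤ k) :
    (∃ (u : Fin (2 * k) → ZMod 2) (w : (projCube (2 * k)).Walk u u),
        w.IsCycle ∧ w.length = 2 * k + 1) ∧
    (∀ (u : Fin (2 * k) → ZMod 2) (w : (projCube (2 * k)).Walk u u),
        w.IsCycle → Odd w.length → 2 * k + 1 ≤ w.length) := by
  refine ⟨?_, fun u w _ hodd => lt_length_of_odd w hodd⟩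
  exact (cycleGraph_isContained_iff (by omega)).1 (cycleGraph_isContained_projCube (by omega))
end

section
/- For every integer k ≥ 1, any pair of vertices of the projective cube PC_{2k} lies on a common cycle of length 2k+1. -/
open SimpleGraph

namespace SimpleGraph

variable {V : Type*} {G : SimpleGraph V}

/-- A sequence of successively adjacent vertices is the support of a walk. -/
theorem exists_walk_support_eq_map_range (f : ℕ → V) (n : ℕ)
    (h : ∀ j < n, G.Adj (f j) (f (j + 1))) :
    ∃ p : G.Walk (f 0) (f n), p.support = (List.range (n + 1)).map f := by
  induction n with
  | zero => exact ⟨.nil, by simp⟩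
  | succ n ih =>
    obtain ⟨p, hp⟩ := ih fun j hj => h j (by lia)
    refine ⟨p.concat (h n (by lia)), ?_⟩
    rw [Walk.support_concat, hp, List.range_succ (n := n + 1)]
    simp

/-- A sequence of at least three distinct vertices, cyclically adjacent, traces a cycle. -/
theorem exists_isCycle_of_injOn (f : ℕ → V) (n : ℕ) (hn : 2 ≤ n)
    (h : ∀ j < n, G.Adj (f j) (f (j + 1))) (hclose : G.Adj (f n) (f 0))
    (hinj : Set.InjOn f (Set.Iic n)) :
    ∃ w : G.Walk (f 0) (f 0), w.IsCycle ∧ w.length = n + 1 ∧ ∀ j ≤ n, f j ∈ w.support := by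
  obtain ⟨p, hp⟩ := exists_walk_support_eq_map_range f n h
  have hlen : p.length = n := by
    have := p.length_support
    simp [hp] at this
    exact this.symm
  have hpath : p.IsPath := by
    rw [Walk.isPath_def, hp]
    refine List.Nodup.map_on (fun x hx y hy hxy => hinj ?_ ?_ hxy) List.nodup_range
    · simpa [Nat.lt_succ_iff] using hx
    · simpa [Nat.lt_succ_iff] using hy
  refine ⟨p.concat hclose, ?_, by simp [hlen], fun j hj => ?_⟩
  · rw [← Walk.isCycle_reverse, Walk.reverse_concat, Walk.cons_isCycle_iff]
    refine ⟨hpath.reverse, fun hmem => ?_⟩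
    rw [Walk.edges_reverse, List.mem_reverse] at hmem
    have := hpath.length_eq_one_of_mem_edges hmem
    lia
  · rw [Walk.support_concat, hp]
    simp only [List.mem_append, List.mem_map, List.mem_range]
    exact .inl ⟨j, by lia, rfl⟩

end SimpleGraph

/-- Any finite set of indices is an initial segment for some ordering of `Fin n`. -/
theorem Fin.exists_perm_val_lt_card_iff {n : ℕ} (s : Finset (Fin n)) :
    ∃ σ : Equiv.Perm (Fin n), ∀ i, (σ i).val < s.card ↔ i ∈ s := by
  have hs : s.card ≤ n := by simpa using s.card_le_univ
  have e : {i // i ∈ s} ≃ {j : Fin n // j.val < s.card} :=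
    Fintype.equivOfCardEq (by
      rw [Fintype.card_coe, Fintype.card_subtype, Fin.card_filter_val_lt, min_eq_right hs])
  refine ⟨e.extendSubtype, fun i => ⟨fun h => ?_, e.extendSubtype_mem i⟩⟩
  by_contra hi
  exact e.extendSubtype_not_mem i hi h

theorem binCayley_adj_of_add_mem {n : ℕ} {Ω : Set (Fin n → ZMod 2)} {x y : Fin n → ZMod 2}
    (hne : x ≠ y) (h : x + y ∈ Ω) : (binCayley Ω).Adj x y :=
  (SimpleGraph.fromRel_adj _ _ _).2 ⟨hne, .inl h⟩

/-- For every `k ≥ 1`, any pair of vertices of `PC_{2k}` lies on a common cycle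
of length `2k+1`. -/
theorem projCube_pair_on_common_cycle (k : ℕ) (hk : 1 ≤ k)
    (u v : Fin (2 * k) → ZMod 2) :
    ∃ w : (projCube (2 * k)).Walk u u,
      w.IsCycle ∧ w.length = 2 * k + 1 ∧ v ∈ w.support := by
  obtain ⟨σ, hσ⟩ := Fin.exists_perm_val_lt_card_iff (Finset.univ.filter fun i => u i ≠ v i)
  set m := (Finset.univ.filter fun i => u i ≠ v i).card
  have hm : m ≤ 2 * k := by
    simpa using (Finset.univ.filter fun i => u i ≠ v i).card_le_univ
  let f : ℕ → Fin (2 * k) → ZMod 2 := fun j i => u i + if (σ i).val < j then 1 else 0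
  have hf0 : f 0 = u := by ext i; simp [f]
  have hfm : f m = v := by
    funext i
    simp only [f, hσ, Finset.mem_filter, Finset.mem_univ, true_and]
    generalize u i = a, v i = b
    revert a b
    decide
  have hne : ∀ j l, j < l → l ≤ 2 * k → f j ≠ f l := by
    intro j l hjl hl he
    have := congrFun he (σ.symm ⟨j, by lia⟩)
    simp [f, hjl] at this
  have hinj : Set.InjOn f (Set.Iic (2 * k)) := by
    intro j hj l hl he
    rcases lt_trichotomy j l with h | h | h
    · exact (hne j l h hl he).elim
    · exact h
    · exact (hne l j h hj he.symm).elim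
  have hadj : ∀ j < 2 * k, (projCube (2 * k)).Adj (f j) (f (j + 1)) := by
    intro j hj
    refine binCayley_adj_of_add_mem (hne j (j + 1) (by lia) hj)
      (.inl ⟨σ.symm ⟨j, hj⟩, funext fun i => ?_⟩)
    have hi : i = σ.symm ⟨j, hj⟩ ↔ (σ i).val = j := by
      rw [Equiv.eq_symm_apply, Fin.ext_iff]
    simp only [f, Pi.add_apply, Pi.single_apply, hi]
    generalize u i = a
    rcases lt_trichotomy (σ i).val j with h | h | h
    · rw [if_pos h, if_pos (by lia), if_neg (by lia)]; revert a; decide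
    · rw [if_neg (by lia), if_pos (by lia), if_pos h]; revert a; decide
    · rw [if_neg (by lia), if_neg (by lia), if_neg (by lia)]; revert a; decide
  have hclose : (projCube (2 * k)).Adj (f (2 * k)) (f 0) := by
    refine binCayley_adj_of_add_mem (hne 0 (2 * k) (by lia) le_rfl).symm
      (.inr (funext fun i => ?_))
    simp only [f, Pi.add_apply, (σ i).isLt, if_true, Nat.not_lt_zero, if_false]
    generalize u i = a
    revert a
    decide
  obtain ⟨w, hw, hlen, hmem⟩ := exists_isCycle_of_injOn f (2 * k) (by lia) hadj hclose hinj
  exact ⟨w.copy hf0 hf0, by rwa [Walk.isCycle_copy], by simpa using hlen,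
    by simpa [hfm] using hmem m hm⟩
end

section
/- For every integer k ≥ 1, the projective cube PC_{2k} is a core; that is, PC_{2k} admits no graph homomorphism to a proper subgraph of itself (equivalently, every graph homomorphism from PC_{2k} to itself is surjective). -/
open SimpleGraph

theorem binVec_add_self {d : ℕ} (x : Fin d → ZMod 2) : x + x = 0 :=
  funext fun i => CharTwo.add_self_eq_zero (x i)

/-- The number of nonzero coordinates of a binary vector. -/
def binWeight {d : ℕ} (x : Fin d → ZMod 2) : ℕ := ∑ i, (x i).val

theorem binWeight_zero {d : ℕ} : binWeight (0 : Fin d → ZMod 2) = 0 := by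
  simp [binWeight]

theorem binWeight_add_single {d : ℕ} (x : Fin d → ZMod 2) (i : Fin d) :
    binWeight (x + Pi.single i 1) = binWeight x + 1 ∨
      binWeight (x + Pi.single i 1) + 1 = binWeight x := by
  have hrest : ∑ j ∈ Finset.univ.erase i, ((x + Pi.single i 1 : Fin d → ZMod 2) j).val =
      ∑ j ∈ Finset.univ.erase i, (x j).val :=
    Finset.sum_congr rfl fun j hj => by simp [Finset.ne_of_mem_erase hj]
  have hi : ((x + Pi.single i 1 : Fin d → ZMod 2) i).val = (x i).val + 1 ∨
      ((x + Pi.single i 1 : Fin d → ZMod 2) i).val + 1 = (x i).val := by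
    simp only [Pi.add_apply, Pi.single_eq_same]
    generalize x i = a
    revert a
    decide
  unfold binWeight
  rw [← Finset.add_sum_erase _ _ (Finset.mem_univ i),
    ← Finset.add_sum_erase _ (fun j => (x j).val) (Finset.mem_univ i), hrest]
  omega

theorem binWeight_add_ones {d : ℕ} (x : Fin d → ZMod 2) :
    binWeight (x + fun _ => 1) + binWeight x = d := by
  have h (a : ZMod 2) : (a + 1).val + a.val = 1 := by revert a; decide
  simp [binWeight, ← Finset.sum_add_distrib, h]

theorem projCube_adj_add_single {d : ℕ} (u : Fin d → ZMod 2) (i : Fin d) :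
    (projCube d).Adj u (u + Pi.single i 1) := by
  refine (SimpleGraph.fromRel_adj _ _ _).2 ⟨fun h => ?_, .inl (.inl ⟨i, ?_⟩)⟩
  · simpa using congrFun h i
  · rw [← add_assoc, binVec_add_self, zero_add]

theorem projCube_adj_add_ones {d : ℕ} (hd : 0 < d) (u : Fin d → ZMod 2) :
    (projCube d).Adj u (u + fun _ => 1) := by
  refine (SimpleGraph.fromRel_adj _ _ _).2 ⟨fun h => ?_, .inl (.inr ?_)⟩
  · simpa using congrFun h ⟨0, hd⟩
  · change u + (u + fun _ => 1) = _
    rw [← add_assoc, binVec_add_self, zero_add]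

theorem add_eq_of_projCube_adj {d : ℕ} {u v : Fin d → ZMod 2} (h : (projCube d).Adj u v) :
    (∃ i, u = v + Pi.single i 1) ∨ u = v + fun _ => 1 := by
  have key (x : Fin d → ZMod 2) (hx : u + v = x) : u = v + x := by
    rw [← hx, add_comm u, ← add_assoc, binVec_add_self, zero_add]
  obtain ⟨-, h⟩ := (SimpleGraph.fromRel_adj _ _ _).1 h
  rw [add_comm v u, or_self] at h
  rcases h with ⟨i, h⟩ | h
  · exact .inl ⟨i, key _ h⟩
  · exact .inr (key _ h)

/-- A walk using an even number of all-ones steps has at least the length of the weight of the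
difference of its ends, and the same parity; one using an odd number of them satisfies the same
relation with the complementary weight plus one. -/
theorem projCube_walk_length {d : ℕ} {u v : Fin d → ZMod 2} (p : (projCube d).Walk u v) :
    (binWeight (u + v) ≤ p.length ∧ binWeight (u + v) ≡ p.length [MOD 2]) ∨
      (d + 1 ≤ p.length + binWeight (u + v) ∧
        d + 1 ≡ p.length + binWeight (u + v) [MOD 2]) := by
  induction p with
  | nil => exact .inl (by rw [binVec_add_self, binWeight_zero]; exact ⟨le_rfl, rfl⟩)
  | @cons u w v h p ih =>
    simp only [SimpleGraph.Walk.length_cons, Nat.ModEq] at ih ⊢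
    have hle := binWeight_add_ones (w + v)
    rcases add_eq_of_projCube_adj h with ⟨i, rfl⟩ | rfl
    · have hs := binWeight_add_single (w + v) i
      rw [add_right_comm w]
      omega
    · rw [add_right_comm w]
      omega

theorem projCube_le_length_of_odd {d : ℕ} {u : Fin d → ZMod 2} (p : (projCube d).Walk u u)
    (hp : Odd p.length) : d + 1 ≤ p.length := by
  have h := projCube_walk_length p
  rw [binVec_add_self, binWeight_zero, Nat.ModEq, Nat.ModEq] at h
  rw [Nat.odd_iff] at hp
  omega

theorem exists_projCube_walk_add_sum {d : ℕ} (u : Fin d → ZMod 2) (s : Finset (Fin d)) :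
    ∃ p : (projCube d).Walk u (u + ∑ i ∈ s, Pi.single i 1), p.length = s.card := by
  induction s using Finset.induction_on with
  | empty => exact ⟨SimpleGraph.Walk.nil.copy rfl (by simp), SimpleGraph.Walk.length_copy _ _ _⟩
  | insert i s hi ih =>
    obtain ⟨p, hp⟩ := ih
    refine ⟨(p.concat (projCube_adj_add_single _ i)).copy rfl ?_, ?_⟩
    · rw [Finset.sum_insert hi, add_assoc, add_comm (Pi.single i 1)]
    · rw [SimpleGraph.Walk.length_copy, SimpleGraph.Walk.length_concat, hp,
        Finset.card_insert_of_notMem hi]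

theorem exists_projCube_walk_length_eq_binWeight {d : ℕ} (u v : Fin d → ZMod 2) :
    ∃ p : (projCube d).Walk u v, p.length = binWeight (u + v) := by
  obtain ⟨p, hp⟩ := exists_projCube_walk_add_sum u (Finset.univ.filter fun i => (u + v) i = 1)
  refine ⟨p.copy rfl ?_, ?_⟩
  · have h (a b : ZMod 2) : (a + if a + b = 1 then 1 else 0) = b := by revert a b; decide
    ext1 j
    simp [Finset.sum_apply, Finset.sum_pi_single, h]
  · have h (a : ZMod 2) : (if a = 1 then 1 else 0) = a.val := by revert a; decide
    rw [SimpleGraph.Walk.length_copy, hp, Finset.card_filter]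
    exact Finset.sum_congr rfl fun i _ => h _

/-- Any two distinct vertices of an even-dimensional projective cube are joined by a walk of odd
length smaller than the odd girth. -/
theorem exists_projCube_walk_odd_lt {k : ℕ} {u v : Fin (2 * k) → ZMod 2} (huv : u ≠ v) :
    ∃ p : (projCube (2 * k)).Walk u v, Odd p.length ∧ p.length < 2 * k + 1 := by
  have hd : 0 < 2 * k := by
    by_contra! h
    exact huv (funext fun i => absurd i.isLt (by omega))
  have hw := binWeight_add_ones (u + v)
  obtain ⟨p, hp⟩ := exists_projCube_walk_length_eq_binWeight u v
  obtain ⟨q, hq⟩ := exists_projCube_walk_length_eq_binWeight (u + fun _ => 1) v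
  have hpos : p.length ≠ 0 := fun h => huv (SimpleGraph.Walk.eq_of_length_eq_zero h)
  rw [add_right_comm] at hq
  rcases Nat.even_or_odd p.length with h | h
  · refine ⟨.cons (projCube_adj_add_ones hd u) q, ?_, ?_⟩ <;>
      simp only [SimpleGraph.Walk.length_cons, Nat.odd_iff, Nat.even_iff] at * <;> omega
  · exact ⟨p, h, by omega⟩

/-- For every `k ≥ 1`, the projective cube `PC_{2k}` is a core: every graph
homomorphism from `PC_{2k}` to itself is surjective. -/
theorem projCube_even_dim_is_core (k : ℕ) (hk : 1 ≤ k)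
    (f : projCube (2 * k) →g projCube (2 * k)) :
    Function.Surjective f := by
  refine Finite.surjective_of_injective fun u v huv => ?_
  by_contra hne
  obtain ⟨p, hodd, hlt⟩ := exists_projCube_walk_odd_lt hne
  have h := projCube_le_length_of_odd ((p.map f).copy rfl huv.symm) (by simpa using hodd)
  simp only [SimpleGraph.Walk.length_copy, SimpleGraph.Walk.length_map] at h
  omega
end

section
/- For every integer n ≥ 1 and every integer i ≥ 0, the i-th level generalized Mycielski graph M^i(C_{2n+1}) of the odd cycle C_{2n+1} has chromatic number 4. -/
open SimpleGraph

/-- The `k`-th level generalized Mycielski graph of `G`: levels `0,…,k` of copies of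
the vertices of `G`, with `(0,i) ~ (0,j)` and `(r,i) ~ (r-1,j)` whenever `i ~ j` in `G`,
together with an apex vertex `none` joined to all vertices `(k, i)` of the top level. -/
def genMycielski {V : Type*} (G : SimpleGraph V) (k : ℕ) :
    SimpleGraph (Option (Fin (k + 1) × V)) :=
  SimpleGraph.fromRel (fun a b =>
    match a, b with
    | some (r, i), some (s, j) => ((r = 0 ∧ s = 0) ∨ (r : ℕ) = (s : ℕ) + 1) ∧ G.Adj i j
    | some (r, _), none => (r : ℕ) = k
    | none, _ => False)

/-- The representative in `{-1, 0, 1}` of the difference of two colors modulo `3`. -/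
def colorStep (a b : Fin 3) : ℤ :=
  if b = a then 0 else if b = a + 1 then 1 else -1

lemma colorStep_swap (a b : Fin 3) : colorStep b a = -colorStep a b := by
  revert a b; decide

lemma odd_colorStep {a b : Fin 3} (h : a ≠ b) : Odd (colorStep a b) := by
  revert a b; decide

/-- A properly colored closed walk of length four has winding number zero. -/
lemma colorStep_add_eq {x y y' z : Fin 3} (hxy : x ≠ y) (hyz : y ≠ z) (hxy' : x ≠ y')
    (hyz' : y' ≠ z) :
    colorStep x y + colorStep y z = colorStep x y' + colorStep y' z := by
  revert x y y' z; decide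

/-- The winding number of the zigzag closed walk (with step `s`) between the colored levels
`f` and `g`. -/
def zigzagWinding {V : Type*} [Fintype V] [Add V] (s : V) (f g : V → Fin 3) : ℤ :=
  ∑ j, (colorStep (f j) (g (j + s)) + colorStep (g j) (f (j + s)))

section

variable {V : Type*} [Fintype V] [AddCommGroup V] {s : V}

lemma sum_shift (s : V) (F : V → ℤ) : ∑ j, F (j + s) = ∑ j, F j :=
  Equiv.sum_comp (Equiv.addRight s) F

lemma zigzagWinding_eq (f g : V → Fin 3) :
    zigzagWinding s f g =
      ∑ j, (colorStep (f j) (g (j + s)) + colorStep (g (j + s)) (f (j + s + s))) := by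
  rw [zigzagWinding, Finset.sum_add_distrib, Finset.sum_add_distrib,
    sum_shift s fun j => colorStep (g j) (f (j + s))]

lemma zigzagWinding_comm (f g : V → Fin 3) : zigzagWinding s f g = zigzagWinding s g f :=
  Finset.sum_congr rfl fun _ _ => add_comm _ _

lemma zigzagWinding_congr {f g h : V → Fin 3}
    (hfg : ∀ j, f j ≠ g (j + s)) (hgf : ∀ j, g j ≠ f (j + s))
    (hgh : ∀ j, g j ≠ h (j + s)) (hhg : ∀ j, h j ≠ g (j + s)) :
    zigzagWinding s f g = zigzagWinding s g h := by
  rw [zigzagWinding_comm, zigzagWinding_eq, zigzagWinding_eq]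
  exact Finset.sum_congr rfl fun j _ => colorStep_add_eq (hgf j) (hfg _) (hgh j) (hhg _)

lemma zigzagWinding_const (f : V → Fin 3) (c : Fin 3) :
    zigzagWinding s f (fun _ => c) = 0 := by
  rw [zigzagWinding, Finset.sum_add_distrib, sum_shift s fun j => colorStep c (f j),
    ← Finset.sum_add_distrib]
  exact Finset.sum_eq_zero fun j _ => by rw [colorStep_swap c, neg_add_cancel]

lemma zigzagWinding_self_ne_zero (hV : Odd (Fintype.card V)) {f : V → Fin 3}
    (hf : ∀ j, f j ≠ f (j + s)) : zigzagWinding s f f ≠ 0 := by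
  have hodd : Odd (∑ j, colorStep (f j) (f (j + s))) := by
    choose t ht using fun j => odd_colorStep (hf j)
    simp only [ht, Finset.sum_add_distrib, ← Finset.mul_sum]
    exact (even_two_mul _).add_odd (by simpa using hV)
  rw [zigzagWinding, Finset.sum_add_distrib]
  obtain ⟨t, ht⟩ := hodd
  omega

/-- There is no sequence of 3-colored levels, properly colored along the zigzags between
consecutive levels, that starts with a repeated level and ends with a constant one. -/
lemma not_exists_colored_levels (hV : Odd (Fintype.card V)) (k : ℕ) (f : ℕ → V → Fin 3)
    (h0 : f 1 = f 0) (c : Fin 3) (hk : f (k + 1) = fun _ => c)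
    (hup : ∀ r ≤ k, ∀ j, f r j ≠ f (r + 1) (j + s))
    (hdown : ∀ r ≤ k, ∀ j, f (r + 1) j ≠ f r (j + s)) : False := by
  have key : ∀ r ≤ k, zigzagWinding s (f r) (f (r + 1)) = zigzagWinding s (f 0) (f 0) := by
    intro r
    induction r with
    | zero => intro _; rw [zero_add, h0]
    | succ r ih =>
      intro hr
      rw [← ih (by omega)]
      exact (zigzagWinding_congr (hup r (by omega)) (hdown r (by omega)) (hup _ hr)
        (hdown _ hr)).symm
  refine zigzagWinding_self_ne_zero (s := s) hV (f := f 0) (fun j => ?_) ?_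
  · simpa [h0] using hup 0 (Nat.zero_le _) j
  · rw [← key k le_rfl, hk, zigzagWinding_const]

end

lemma genMycielski_colorable_succ {V : Type*} {G : SimpleGraph V} {m : ℕ}
    (hG : G.Colorable m) (k : ℕ) : (genMycielski G k).Colorable (m + 1) := by
  obtain ⟨C⟩ := hG
  have coloring : (genMycielski G k).Coloring (Option (Fin m)) := by
    refine Coloring.mk (fun v => v.map fun p => C p.2) ?_
    rintro (_ | ⟨r, i⟩) (_ | ⟨t, j⟩) h
    · exact absurd rfl h.ne
    · simp
    · simp
    · simp only [genMycielski, fromRel_adj] at h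
      have hij : G.Adj i j := h.2.elim (fun h => h.2) fun h => h.2.symm
      simpa using C.valid hij
  simpa using coloring.colorable

/-- If translation by `s` moves every vertex of `G`, a graph on a group of odd order, to a
neighbor, then no generalized Mycielski graph
of `G` is 3-colorable. -/
lemma not_colorable_three_genMycielski {V : Type*} [Fintype V] [AddCommGroup V]
    (hV : Odd (Fintype.card V)) {G : SimpleGraph V} {s : V} (hG : ∀ j, G.Adj j (j + s)) (k : ℕ) :
    ¬ (genMycielski G k).Colorable 3 := by
  rintro ⟨C⟩
  let level : ℕ → V → Fin 3 := fun r j =>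
    if h : r < k + 1 then C (some (⟨r, h⟩, j)) else C none
  have hlevel : ∀ r ≤ k, ∀ i j, G.Adj i j → level r i ≠ level (r + 1) j := by
    intro r hr i j hij
    have hr' : r < k + 1 := by omega
    by_cases h : r + 1 < k + 1
    · simp only [level, hr', h, dite_true]
      exact C.valid (by simp [genMycielski, hij.symm])
    · simp only [level, hr', h, dite_true, dite_false]
      exact C.valid (by simp [genMycielski]; omega)
  have hbase : ∀ i j, G.Adj i j → level 0 i ≠ level 0 j := by
    intro i j hij
    simp only [level, Nat.succ_pos, dite_true]
    exact C.valid (by simp [genMycielski, hij, hij.ne])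
  refine not_exists_colored_levels (s := s) hV (k + 1) (fun r => level (r - 1)) rfl (C none)
    (by funext j; simp [level]) ?_ ?_
  · rintro (_ | r) hr j
    · exact hbase _ _ (hG j)
    · exact hlevel r (by omega) _ _ (hG j)
  · rintro (_ | r) hr j
    · exact hbase _ _ (hG j)
    · exact (hlevel r (by omega) _ _ (hG j).symm).symm

/-- For every `n ≥ 1` and every `i ≥ 0`, the `i`-th level generalized Mycielski
graph of the odd cycle `C_{2n+1}` has chromatic number `4`. -/
theorem genMycielski_oddCycle_chromaticNumber (n : ℕ) (hn : 1 ≤ n) (i : ℕ) :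
    (genMycielski (cycleGraph (2 * n + 1)) i).chromaticNumber = 4 := by
  obtain ⟨p, rfl⟩ := Nat.exists_eq_add_of_le' hn
  have hcol : (cycleGraph (2 * (p + 1) + 1)).Colorable 3 :=
    chromaticNumber_le_iff_colorable.mp
      (chromaticNumber_cycleGraph_of_odd _ (by omega) ⟨p + 1, rfl⟩).le
  refine le_antisymm (chromaticNumber_le_iff_colorable.mpr (genMycielski_colorable_succ hcol i)) ?_
  have hnot : ¬ (genMycielski (cycleGraph (2 * (p + 1) + 1)) i).Colorable 3 :=
    not_colorable_three_genMycielski (s := 1) (by rw [Fintype.card_fin]; exact odd_two_mul_add_one (p + 1))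
      (fun j => (cycleGraph_adj (n := 2 * p + 1)).mpr (Or.inr (add_sub_cancel_left j 1))) i
  rw [← chromaticNumber_le_iff_colorable, not_le] at hnot
  exact Order.add_one_le_of_lt hnot
end

section
/- Let G = Cay(Γ, Ω) be a binary Cayley graph whose odd-girth is 2k+1. Then the projective cube PC_{2k} is a subgraph of G, i.e., there is an injective graph homomorphism from PC_{2k} into G. -/
open SimpleGraph

/-- `G` has odd-girth `g`: it contains a cycle of length `g` (with `g` odd this is an
odd cycle), and every odd cycle of `G` has length at least `g`. -/
def HasOddGirth {V : Type*} (G : SimpleGraph V) (g : ℕ) : Prop :=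
  (∃ (u : V) (w : G.Walk u u), w.IsCycle ∧ w.length = g) ∧
    ∀ (u : V) (w : G.Walk u u), w.IsCycle → Odd w.length → g ≤ w.length

/-- Reducing a walk to a path either preserves the parity of its length or reveals an odd cycle. -/
theorem exists_odd_isCycle_or_isPath {V : Type*} {G : SimpleGraph V} {u v : V} (p : G.Walk u v) :
    (∃ (x : V) (c : G.Walk x x), c.IsCycle ∧ Odd c.length ∧ c.length ≤ p.length) ∨
      ∃ q : G.Walk u v, q.IsPath ∧ q.length ≤ p.length ∧ (Odd q.length ↔ Odd p.length) := by
  classical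
  induction p with
  | nil => exact .inr ⟨.nil, by simp⟩
  | @cons a b c h p ih =>
    rcases ih with ⟨x, c, hc, hodd, hle⟩ | ⟨q, hq, hle, hpar⟩
    · exact .inl ⟨x, c, hc, hodd, by simp only [Walk.length_cons]; omega⟩
    by_cases ha : a ∈ q.support
    · have hlen : (q.takeUntil a ha).length + (q.dropUntil a ha).length = q.length := by
        rw [← Walk.length_append, Walk.take_spec]
      by_cases ht : Odd (q.takeUntil a ha).length
      · refine .inr ⟨q.dropUntil a ha, hq.dropUntil ha, ?_, ?_⟩
        · simp only [Walk.length_cons]; omega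
        · simp only [Walk.length_cons, Nat.odd_add_one, ← hpar, ← hlen]
          grind
      · refine .inl ⟨a, .cons h (q.takeUntil a ha), ?_, ?_, ?_⟩
        · refine (Walk.cons_isCycle_iff _ h).2 ⟨hq.takeUntil ha, fun he => ht ?_⟩
          rw [(hq.takeUntil ha).length_eq_one_of_mem_edges (Sym2.eq_swap ▸ he)]
          exact odd_one
        · rwa [Walk.length_cons, Nat.odd_add_one]
        · simp only [Walk.length_cons]; omega
    · exact .inr ⟨.cons h q, hq.cons ha, by simpa using hle, by
        simp only [Walk.length_cons, Nat.odd_add_one, hpar]⟩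

theorem exists_odd_isCycle_length_le {V : Type*} {G : SimpleGraph V} {u : V} (p : G.Walk u u)
    (hp : Odd p.length) :
    ∃ (x : V) (c : G.Walk x x), c.IsCycle ∧ Odd c.length ∧ c.length ≤ p.length := by
  rcases exists_odd_isCycle_or_isPath p with h | ⟨q, hq, -, hpar⟩
  · exact h
  · have hq0 := Walk.length_eq_zero_iff.2 (Walk.isPath_iff_nil.1 hq)
    simp [hp, hq0] at hpar

theorem exists_walk_binCayley {n : ℕ} {Ω : Set (Fin n → ZMod 2)} (h0 : 0 ∉ Ω)
    (l : List (Fin n → ZMod 2)) (hl : ∀ a ∈ l, a ∈ Ω) :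
    ∀ x, ∃ p : (binCayley Ω).Walk x (l.sum + x), p.length = l.length := by
  induction l with
  | nil => exact fun x => ⟨Walk.nil.copy rfl (by simp), by rw [Walk.length_copy]; rfl⟩
  | cons a l ih =>
    intro x
    have ha : a ∈ Ω := hl a (by simp)
    obtain ⟨p, hp⟩ := ih (fun b hb => hl b (by simp [hb])) (x + a)
    have hadj : (binCayley Ω).Adj x (x + a) := by
      refine (fromRel_adj _ _ _).2 ⟨?_, .inl ?_⟩
      · intro h
        exact h0 ((left_eq_add.1 h) ▸ ha)
      · rwa [← add_assoc, ZModModule.add_self, zero_add]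
    exact ⟨(Walk.cons hadj p).copy rfl (by rw [List.sum_cons]; abel), by
      rw [Walk.length_copy, Walk.length_cons, hp, List.length_cons]⟩

theorem exists_list_of_walk_binCayley {n : ℕ} {Ω : Set (Fin n → ZMod 2)} {u v : Fin n → ZMod 2}
    (p : (binCayley Ω).Walk u v) :
    ∃ l : List (Fin n → ZMod 2), l.length = p.length ∧ (∀ a ∈ l, a ∈ Ω) ∧ l.sum = u + v := by
  induction p with
  | nil => exact ⟨[], by simp, by simp, by simp [ZModModule.add_self]⟩
  | @cons a b c h p ih =>
    obtain ⟨l, hlen, hl, hsum⟩ := ih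
    have hab : a + b ∈ Ω := by
      rcases ((fromRel_adj _ _ _).1 h).2 with h | h
      · exact h
      · rwa [add_comm]
    refine ⟨(a + b) :: l, by simp [hlen], by simpa [hab] using hl, ?_⟩
    rw [List.sum_cons, hsum, add_assoc, ← add_assoc b, ZModModule.add_self, zero_add]

/-- Vanishing sums of an odd number of elements of `Ω` have at least odd-girth many terms. -/
theorem HasOddGirth.le_card_of_sum_eq_zero {n g : ℕ} {Ω : Set (Fin n → ZMod 2)} (h0 : 0 ∉ Ω)
    (hog : HasOddGirth (binCayley Ω) g) {ι : Type*} (ω : ι → Fin n → ZMod 2)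
    (hω : ∀ i, ω i ∈ Ω) (S : Finset ι) (hS : Odd S.card) (hsum : ∑ i ∈ S, ω i = 0) :
    g ≤ S.card := by
  have hlist : (S.toList.map ω).sum = 0 := by rw [Finset.sum_map_toList, hsum]
  obtain ⟨p, hp⟩ := exists_walk_binCayley h0 (S.toList.map ω) (by simp [hω]) 0
  rw [List.length_map, Finset.length_toList] at hp
  obtain ⟨x, c, hc, hodd, hle⟩ := exists_odd_isCycle_length_le
    (p.copy rfl (by rw [hlist, zero_add])) (by simpa [hp] using hS)
  have := hog.2 x c hc hodd
  simp only [Walk.length_copy] at hle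
  omega

/-- If a binary Cayley graph has odd-girth `2k+1`, then the projective cube
`PC_{2k}` is a subgraph of it. -/
theorem projCube_subgraph_of_binCayley (n k : ℕ)
    (Ω : Set (Fin n → ZMod 2)) (h0 : 0 ∉ Ω)
    (hog : HasOddGirth (binCayley Ω) (2 * k + 1)) :
    ∃ f : projCube (2 * k) →g binCayley Ω, Function.Injective f := by
  obtain ⟨u, w, -, hwlen⟩ := hog.1
  obtain ⟨l, hlen, hl, hlsum⟩ := exists_list_of_walk_binCayley w
  rw [hwlen] at hlen
  rw [ZModModule.add_self] at hlsum
  obtain ⟨ω, hω, hωsum⟩ : ∃ ω : Fin (2 * k + 1) → Fin n → ZMod 2,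
      (∀ i, ω i ∈ Ω) ∧ ∑ i, ω i = 0 := by
    rw [← hlen]
    exact ⟨l.get, fun i => hl _ (l.get_mem i), by
      rw [← List.sum_ofFn, List.ofFn_get, hlsum]⟩
  let f := Fintype.linearCombination (ZMod 2) (fun i : Fin (2 * k) => ω i.castSucc)
  have hlast : ∑ i : Fin (2 * k), ω i.castSucc = ω (Fin.last _) := by
    rw [Fin.sum_univ_castSucc] at hωsum
    rwa [← sub_eq_zero, ZModModule.sub_eq_add]
  have hinj : Function.Injective f := by
    rw [injective_iff_map_eq_zero]
    intro x hx
    let S : Finset (Fin (2 * k + 1)) :=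
      (Finset.univ.filter (fun i => x i ≠ 0)).map Fin.castSuccEmb
    have hcard : S.card ≤ 2 * k := by
      simpa [S] using Finset.card_le_univ (Finset.univ.filter (fun i => x i ≠ 0))
    have hS : ∑ i ∈ S, ω i = 0 := by
      rw [← hx, Fintype.linearCombination_apply, Finset.sum_map, Finset.sum_filter]
      refine Finset.sum_congr rfl fun i _ => ?_
      have : ∀ a : ZMod 2, a = 0 ∨ a = 1 := by decide
      rcases this (x i) with h | h <;> simp [h]
    have hSc : ∑ i ∈ Sᶜ, ω i = 0 := by
      rw [← hωsum, ← Finset.sum_add_sum_compl S, hS, zero_add]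
    have hcc : Sᶜ.card = 2 * k + 1 - S.card := by simp [Finset.card_compl]
    rcases Nat.even_or_odd S.card with hp | hp
    · have hpc : Odd Sᶜ.card := by rw [hcc]; grind
      have := hog.le_card_of_sum_eq_zero h0 ω hω Sᶜ hpc hSc
      have hS0 : S = ∅ := Finset.card_eq_zero.1 (by omega)
      funext i
      simp only [S, Finset.map_eq_empty, Finset.filter_eq_empty_iff] at hS0
      simpa using hS0 (Finset.mem_univ i)
    · have := hog.le_card_of_sum_eq_zero h0 ω hω S hp hS
      omega
  have hmem : ∀ y ∈ ({x | ∃ i, x = Pi.single i 1} ∪ {x | x = fun _ => 1} :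
      Set (Fin (2 * k) → ZMod 2)), f y ∈ Ω := by
    rintro y (⟨i, rfl⟩ | rfl)
    · simpa [f] using hω i.castSucc
    · simpa [f, Fintype.linearCombination_apply, hlast] using hω (Fin.last _)
  refine ⟨⟨f, fun {a b} hab => ?_⟩, hinj⟩
  obtain ⟨hne, hab⟩ := (fromRel_adj _ _ _).1 hab
  refine (fromRel_adj _ _ _).2 ⟨hinj.ne hne, ?_⟩
  rw [← map_add, ← map_add]
  exact hab.imp (hmem _) (hmem _)
end

section
/- There is no binary Cayley graph of chromatic number 3; that is, for every binary Cayley graph G = Cay(Γ, Ω), the chromatic number of G is not equal to 3. -/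
open SimpleGraph

/-- The representative `1` or `-1` in `ℤ` of a nonzero element of `ℤ/3ℤ`. -/
def signLift (r : ZMod 3) : ℤ := if r = 1 then 1 else -1

theorem odd_signLift (r : ZMod 3) : Odd (signLift r) := by
  unfold signLift
  split_ifs <;> decide

theorem signLift_add_signLift_comm : ∀ a b c e : ZMod 3, a ≠ b → b ≠ e → a ≠ c → c ≠ e →
    signLift (b - a) + signLift (e - b) = signLift (c - a) + signLift (e - c) := by
  decide

theorem signLift_sub_add_signLift_sub : ∀ a b : ZMod 3, a ≠ b →
    signLift (b - a) + signLift (a - b) = 0 := by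
  decide

/-- The total increment of a `ℤ/3ℤ`-valued function along the walk from `x` whose successive
steps are the entries of a list, each increment being lifted to `1` or `-1`. -/
def winding {Γ : Type*} [Add Γ] (c : Γ → ZMod 3) : Γ → List Γ → ℤ
  | _, [] => 0
  | x, a :: L => signLift (c (x + a) - c x) + winding c (x + a) L

section Winding

variable {Γ : Type*} [AddCommGroup Γ] {c : Γ → ZMod 3}

theorem winding_append (x : Γ) (L M : List Γ) :
    winding c x (L ++ M) = winding c x L + winding c (x + L.sum) M := by
  induction L generalizing x with
  | nil => simp [winding]
  | cons a L ih => simp [winding, ih, add_assoc]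

theorem odd_winding_iff (x : Γ) (L : List Γ) : Odd (winding c x L) ↔ Odd L.length := by
  induction L generalizing x with
  | nil => simp [winding]
  | cons a L ih =>
    have h := odd_signLift (c (x + a) - c x)
    simp only [winding, List.length_cons, Int.odd_add, Nat.odd_add_one, ← ih (x + a), h, true_iff,
      Int.not_odd_iff_even]

theorem winding_perm {Ω : Set Γ} (hc : ∀ x, ∀ a ∈ Ω, c x ≠ c (x + a)) {L M : List Γ}
    (h : L.Perm M) (hL : ∀ a ∈ L, a ∈ Ω) (x : Γ) : winding c x L = winding c x M := by
  induction h generalizing x with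
  | nil => rfl
  | cons a _ ih => simp only [winding, ih fun b hb => hL b (List.mem_cons_of_mem _ hb)]
  | swap a b L =>
    have ha : a ∈ Ω := hL a (by simp)
    have hb : b ∈ Ω := hL b (by simp)
    have hab := hc (x + a) b hb
    rw [add_right_comm] at hab
    have := signLift_add_signLift_comm _ _ _ _ (hc x b hb) (hc (x + b) a ha) (hc x a ha) hab
    simp only [winding, add_right_comm x a b]
    linarith
  | trans h₁ _ ih₁ ih₂ =>
    exact (ih₁ hL x).trans (ih₂ (fun a ha => hL a (h₁.mem_iff.2 ha)) x)

theorem winding_append_self {Ω : Set Γ} (hΓ : ∀ a : Γ, a + a = 0)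
    (hc : ∀ x, ∀ a ∈ Ω, c x ≠ c (x + a)) {L : List Γ} (hL : ∀ a ∈ L, a ∈ Ω) (x : Γ) :
    winding c x (L ++ L) = 0 := by
  induction L generalizing x with
  | nil => rfl
  | cons a L ih =>
    have hp : (a :: L ++ a :: L).Perm (a :: a :: (L ++ L)) :=
      List.Perm.cons a List.perm_middle
    rw [winding_perm hc hp (fun b hb => (List.mem_append.1 hb).elim (hL b) (hL b))]
    have hx : x + a + a = x := by rw [add_assoc, hΓ, add_zero]
    have := signLift_sub_add_signLift_sub _ _ (hc x a (hL a (by simp)))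
    simp only [winding, hx, ih fun b hb => hL b (List.mem_cons_of_mem _ hb)]
    linarith

theorem even_length_of_sum_eq_zero {Ω : Set Γ} (hΓ : ∀ a : Γ, a + a = 0)
    (hc : ∀ x, ∀ a ∈ Ω, c x ≠ c (x + a)) {L : List Γ} (hL : ∀ a ∈ L, a ∈ Ω) (hs : L.sum = 0) :
    Even L.length := by
  have h := winding_append_self hΓ hc hL 0
  rw [winding_append, hs, add_zero] at h
  have h₀ : winding c 0 L = 0 := by linarith
  rw [← Nat.not_odd_iff_even, ← odd_winding_iff (c := c) 0, h₀]
  decide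

end Winding

theorem exists_list_of_mem_span {V : Type*} [AddCommGroup V] [Module (ZMod 2) V] {Ω : Set V}
    {p : V × ZMod 2} (hp : p ∈ Submodule.span (ZMod 2) ((fun a => (a, (1 : ZMod 2))) '' Ω)) :
    ∃ L : List V, (∀ a ∈ L, a ∈ Ω) ∧ L.sum = p.1 ∧ (L.length : ZMod 2) = p.2 := by
  induction hp using Submodule.span_induction with
  | mem p hp =>
    obtain ⟨a, ha, rfl⟩ := hp
    exact ⟨[a], by simpa using ha, by simp, by simp⟩
  | zero => exact ⟨[], by simp, by simp, by simp⟩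
  | add p q _ _ ihp ihq =>
    obtain ⟨L, hL, hLs, hLl⟩ := ihp
    obtain ⟨M, hM, hMs, hMl⟩ := ihq
    refine ⟨L ++ M, fun a ha => ?_, by simp [hLs, hMs], by simp [hLl, hMl]⟩
    exact (List.mem_append.1 ha).elim (hL a) (hM a)
  | smul r p _ ih =>
    have hr : r = 0 ∨ r = 1 := by revert r; decide
    rcases hr with rfl | rfl
    · exact ⟨[], by simp, by simp, by simp⟩
    · simpa using ih

theorem exists_linearMap_eq_one {V : Type*} [AddCommGroup V] [Module (ZMod 2) V] {Ω : Set V}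
    (h : ∀ L : List V, (∀ a ∈ L, a ∈ Ω) → L.sum = 0 → Even L.length) :
    ∃ f : V →ₗ[ZMod 2] ZMod 2, ∀ a ∈ Ω, f a = 1 := by
  have hS : ((0 : V), (1 : ZMod 2)) ∉
      Submodule.span (ZMod 2) ((fun a => (a, (1 : ZMod 2))) '' Ω) := by
    intro hmem
    obtain ⟨L, hL, hs, hl⟩ := exists_list_of_mem_span hmem
    rw [(ZMod.natCast_eq_zero_iff_even).2 (h L hL hs)] at hl
    exact zero_ne_one hl
  obtain ⟨f, hf, hker⟩ := Submodule.exists_le_ker_of_notMem hS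
  refine ⟨f ∘ₗ LinearMap.inl _ _ _, fun a ha => ?_⟩
  have hfa : f (a, 1) = 0 := hker (Submodule.subset_span ⟨a, ha, rfl⟩)
  have hsplit : f (a, 1) = f (a, 0) + f (0, 1) := by rw [← map_add]; simp
  rw [hsplit] at hfa
  change f (a, 0) = 1
  generalize f (a, 0) = s at *
  generalize f (0, 1) = t at *
  clear hsplit
  revert s t
  decide

/-- (Payan) No binary Cayley graph has chromatic number `3`. -/
theorem binCayley_chromaticNumber_ne_three (n : ℕ)
    (Ω : Set (Fin n → ZMod 2)) (h0 : 0 ∉ Ω) :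
    (binCayley Ω).chromaticNumber ≠ 3 := by
  intro h3
  obtain ⟨c⟩ : (binCayley Ω).Colorable 3 := chromaticNumber_le_iff_colorable.1 h3.le
  have hΓ (a : Fin n → ZMod 2) : a + a = 0 := funext fun i => CharTwo.add_self_eq_zero (a i)
  have hadj (x a : Fin n → ZMod 2) (ha : a ∈ Ω) : (binCayley Ω).Adj x (x + a) := by
    refine ⟨fun hx => h0 ?_, Or.inl ?_⟩
    · rwa [← left_eq_add.1 hx]
    · change x + (x + a) ∈ Ω
      rwa [← add_assoc, hΓ, zero_add]
  obtain ⟨f, hf⟩ := exists_linearMap_eq_one fun L hL hs =>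
    even_length_of_sum_eq_zero (c := fun x => (c x : ZMod 3)) hΓ
      (fun x a ha => c.valid (hadj x a ha)) hL hs
  have h2 : (binCayley Ω).Colorable 2 := by
    refine ⟨Coloring.mk (fun x => (f x : ZMod 2)) fun {u v} huv heq => ?_⟩
    have hmem : u + v ∈ Ω := huv.2.elim id fun h => add_comm u v ▸ h
    have h1 := hf _ hmem
    rw [map_add, show f u = f v from heq, CharTwo.add_self_eq_zero] at h1
    exact zero_ne_one h1
  have := chromaticNumber_le_iff_colorable.2 h2
  rw [h3] at this
  exact absurd this (by decide)
end

section
/- Let G be a finite graph and let H = Cay((ℤ/2ℤ)^n, S) be a binary Cayley graph. Then there exists a graph homomorphism from G to H if and only if there exists a graph homomorphism from the power graph Ĝ to H. -/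
open SimpleGraph

/-- The power graph of `G`: vertices are the subsets of `V(G)`, two subsets being
adjacent iff their symmetric difference is the vertex set `{u, v}` of an edge of `G`. -/
def powerGraph {V : Type*} (G : SimpleGraph V) : SimpleGraph (Set V) :=
  SimpleGraph.fromRel (fun A B => ∃ u v, G.Adj u v ∧ symmDiff A B = {u, v})

theorem binCayley_adj {n : ℕ} {Ω : Set (Fin n → ZMod 2)} (h0 : 0 ∉ Ω)
    {u v : Fin n → ZMod 2} : (binCayley Ω).Adj u v ↔ u + v ∈ Ω := by
  rw [binCayley, SimpleGraph.fromRel_adj, add_comm v u, or_self, and_iff_right_iff_imp]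
  rintro h rfl
  exact h0 (by rwa [ZModModule.add_self] at h)

theorem powerGraph_adj {V : Type*} {G : SimpleGraph V} {A B : Set V} :
    (powerGraph G).Adj A B ↔ ∃ u v, G.Adj u v ∧ symmDiff A B = {u, v} := by
  rw [powerGraph, SimpleGraph.fromRel_adj, symmDiff_comm B A, or_self, and_iff_right_iff_imp]
  rintro ⟨u, v, -, h⟩ rfl
  rw [symmDiff_self] at h
  exact (Set.insert_nonempty u {v}).ne_empty h.symm

theorem Set.indicator_add_indicator_eq_symmDiff {α M : Type*} [AddCommGroup M]
    [Module (ZMod 2) M] (A B : Set α) (f : α → M) (a : α) :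
    A.indicator f a + B.indicator f a = (symmDiff A B).indicator f a := by
  by_cases hA : a ∈ A <;> by_cases hB : a ∈ B <;>
    simp [Set.mem_symmDiff, hA, hB, ZModModule.add_self]

/-- For a finite graph `G` and a binary Cayley graph `H`, there is a homomorphism
`G → H` iff there is a homomorphism from the power graph of `G` to `H`. -/
theorem hom_iff_powerGraph_hom {V : Type*} [Fintype V] (G : SimpleGraph V)
    (n : ℕ) (S : Set (Fin n → ZMod 2)) (h0 : 0 ∉ S) :
    Nonempty (G →g binCayley S) ↔ Nonempty (powerGraph G →g binCayley S) := by
  classical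
  refine ⟨fun ⟨f⟩ => ⟨⟨fun A => ∑ v, A.indicator f v, fun {A B} h => ?_⟩⟩,
    fun ⟨g⟩ => ⟨⟨fun v => g {v}, fun {u v} h => g.map_rel (powerGraph_adj.2 ⟨u, v, h, ?_⟩)⟩⟩⟩
  · obtain ⟨u, v, huv, hAB⟩ := powerGraph_adj.1 h
    have key : ∑ x, A.indicator f x + ∑ x, B.indicator f x = f u + f v := by
      rw [← Finset.sum_add_distrib]
      simp_rw [Set.indicator_add_indicator_eq_symmDiff, hAB]
      rw [← Finset.coe_pair, Finset.sum_indicator_subset _ (Finset.subset_univ _),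
        Finset.sum_pair huv.ne]
    rw [binCayley_adj h0, key]
    exact (binCayley_adj h0).1 (f.map_rel huv)
  · ext x
    have := h.ne
    simp only [Set.mem_symmDiff, Set.mem_singleton_iff, Set.mem_insert_iff]
    grind
end

section
/- For every n ≥ 2, the power graph of the path P_n on n vertices has exactly two connected components, each isomorphic to the hypercube Q_{n−1} of dimension n−1. -/
open SimpleGraph

/-- The hypercube of dimension `d`: two vectors of `(ℤ/2ℤ)^d` are adjacent iff
they differ in exactly one coordinate. -/
def hypercube (d : ℕ) : SimpleGraph (Fin d → ZMod 2) :=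
  SimpleGraph.fromRel (fun u v => ∃ i, u + v = Pi.single i 1)

theorem hypercube_adj {d : ℕ} {u v : Fin d → ZMod 2} :
    (hypercube d).Adj u v ↔ ∃ i, u + v = Pi.single i 1 := by
  simp only [hypercube, fromRel_adj, add_comm v u, or_self, and_iff_right_iff_imp]
  rintro ⟨i, hi⟩ rfl
  simpa [CharTwo.add_self_eq_zero] using congrFun hi i

theorem hypercube_preconnected (d : ℕ) : (hypercube d).Preconnected := by
  have key (x z : Fin d → ZMod 2) (s : Finset (Fin d)) :
      (hypercube d).Reachable x (x + ∑ i ∈ s, Pi.single i (z i)) := by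
    induction s using Finset.induction_on with
    | empty => simp
    | insert i s hi ih =>
      refine ih.trans ?_
      rw [Finset.sum_insert hi]
      have hz : ∀ a : ZMod 2, a = 0 ∨ a = 1 := by decide
      rcases hz (z i) with h | h
      · simp [h]
      · refine (hypercube_adj.mpr ⟨i, ?_⟩).reachable
        rw [h, add_left_comm x, add_left_comm, ZModModule.add_self, add_zero]
  intro x y
  have h := key x (y - x) Finset.univ
  rwa [Finset.univ_sum_single, add_sub_cancel] at h

/-- In a disjoint union of copies of a preconnected graph, every connected component is
isomorphic to that graph. -/
theorem nonempty_induce_supp_iso_of_iso_boxProd_bot {V W ι : Type*} {G : SimpleGraph V}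
    {H : SimpleGraph W} (hH : H.Preconnected) (e : G ≃g H □ (⊥ : SimpleGraph ι))
    (C : G.ConnectedComponent) : Nonempty (G.induce C.supp ≃g H) := by
  induction C using ConnectedComponent.ind with | _ A => ?_
  have hmem (B : V) : B ∈ (G.connectedComponentMk A).supp ↔ (e B).2 = (e A).2 := by
    rw [ConnectedComponent.mem_supp_iff, ConnectedComponent.eq, ← e.reachable_iff,
      reachable_boxProd, reachable_bot]
    exact and_iff_right (hH _ _)
  refine ⟨⟨⟨fun B => (e B).1, fun x => ⟨e.symm (x, (e A).2), by simp [hmem]⟩, ?_, ?_⟩, ?_⟩⟩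
  · rintro ⟨B, hB⟩
    simp [← (hmem B).mp hB]
  · intro x
    simp
  · rintro ⟨B, hB⟩ ⟨B', hB'⟩
    rw [hmem] at hB hB'
    simp [← e.map_adj_iff, boxProd_adj, hB, hB']

/-- The parity of the number of elements of `A` that are at most `k`. -/
noncomputable def prefixParity {n : ℕ} (A : Set (Fin n)) (k : Fin n) : ZMod 2 :=
  ∑ j ∈ Finset.Iic k, A.indicator 1 j

theorem prefixParity_symmDiff {n : ℕ} (A B : Set (Fin n)) :
    prefixParity (symmDiff A B) = prefixParity A + prefixParity B := by
  ext k
  simp only [prefixParity, Pi.add_apply, ← Finset.sum_add_distrib]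
  refine Finset.sum_congr rfl fun j _ => ?_
  by_cases hA : j ∈ A <;> by_cases hB : j ∈ B <;>
    simp [Set.mem_symmDiff, hA, hB, CharTwo.add_self_eq_zero]

theorem prefixParity_singleton {n : ℕ} (i k : Fin n) :
    prefixParity {i} k = if i ≤ k then 1 else 0 := by
  classical
  simp [prefixParity, Set.indicator_apply, -Finset.sum_boole]

theorem prefixParity_succ {d : ℕ} (A : Set (Fin (d + 1))) (i : Fin d) :
    prefixParity A i.succ = A.indicator 1 i.succ + prefixParity A i.castSucc := by
  have h : Finset.Iic i.succ = insert i.succ (Finset.Iic i.castSucc) := by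
    ext j
    simp only [Finset.mem_Iic, Finset.mem_insert, Fin.le_def, Fin.ext_iff, Fin.val_succ,
      Fin.val_castSucc]
    omega
  rw [prefixParity, h, Finset.sum_insert (by simp), prefixParity]

theorem prefixParity_injective (d : ℕ) :
    Function.Injective (prefixParity : Set (Fin (d + 1)) → Fin (d + 1) → ZMod 2) := by
  intro A B h
  refine Set.indicator_one_inj (ZMod 2) (funext fun j => ?_)
  cases j using Fin.cases with
  | zero =>
    have h0 : Finset.Iic (0 : Fin (d + 1)) = {0} := by
      ext
      simp
    simpa only [prefixParity, h0, Finset.sum_singleton] using congrFun h 0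
  | succ i =>
    have hs := congrFun h i.succ
    rwa [prefixParity_succ, prefixParity_succ, h, add_left_inj] at hs

theorem prefixParity_bijective (d : ℕ) :
    Function.Bijective (prefixParity : Set (Fin (d + 1)) → Fin (d + 1) → ZMod 2) := by
  rw [Fintype.bijective_iff_injective_and_card]
  exact ⟨prefixParity_injective d, by simp⟩

theorem prefixParity_pair {d : ℕ} (i : Fin d) :
    prefixParity {i.castSucc, i.succ} = Pi.single i.castSucc 1 := by
  have h : ({i.castSucc, i.succ} : Set (Fin (d + 1))) = symmDiff {i.castSucc} {i.succ} := by
    rw [(Set.disjoint_singleton.mpr (Fin.castSucc_lt_succ (i := i)).ne).symmDiff_eq_sup]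
    rfl
  ext k
  rw [h, prefixParity_symmDiff, Pi.add_apply, prefixParity_singleton, prefixParity_singleton]
  rcases lt_trichotomy k i.castSucc with hk | rfl | hk
  · simp [hk.ne, hk.not_ge, (hk.trans Fin.castSucc_lt_succ).not_ge]
  · simp
  · rw [if_pos hk.le, if_pos (Fin.castSucc_lt_iff_succ_le.mp hk), Pi.single_eq_of_ne hk.ne']
    exact CharTwo.add_self_eq_zero 1

theorem powerGraph_pathGraph_adj {d : ℕ} {A B : Set (Fin (d + 1))} :
    (powerGraph (pathGraph (d + 1))).Adj A B ↔
      ∃ i : Fin d, prefixParity A + prefixParity B = Pi.single i.castSucc 1 := by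
  simp_rw [powerGraph_adj, ← prefixParity_symmDiff, ← prefixParity_pair,
    (prefixParity_injective d).eq_iff, pathGraph_adj]
  constructor
  · have aux {u v : Fin (d + 1)} (h : u.val + 1 = v.val) :
        ∃ i : Fin d, ({u, v} : Set (Fin (d + 1))) = {i.castSucc, i.succ} := by
      have hu : u.val < d := by omega
      have hv : v = (⟨u, hu⟩ : Fin d).succ := Fin.ext h.symm
      exact ⟨⟨u, hu⟩, by rw [hv]; rfl⟩
    rintro ⟨u, v, h | h, hs⟩
    · rw [hs]
      exact aux h
    · rw [hs, Set.pair_comm]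
      exact aux h
  · rintro ⟨i, hi⟩
    exact ⟨i.castSucc, i.succ, Or.inl rfl, hi⟩

/-- The power graph of a path is the disjoint union of two hypercubes. -/
noncomputable def powerGraphPathGraphIso (d : ℕ) :
    powerGraph (pathGraph (d + 1)) ≃g hypercube d □ (⊥ : SimpleGraph (ZMod 2)) where
  toEquiv := (Equiv.ofBijective _ (prefixParity_bijective d)).trans
    ((Fin.snocEquiv fun _ => ZMod 2).symm.trans (Equiv.prodComm _ _))
  map_rel_iff' {A B} := by
    rw [powerGraph_pathGraph_adj]
    simp only [boxProd_adj, hypercube_adj, bot_adj, false_and, or_false, Equiv.trans_apply,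
      Equiv.prodComm_apply, Fin.snocEquiv, Equiv.ofBijective_apply, Equiv.coe_fn_symm_mk,
      Prod.swap_prod_mk, ← exists_and_right]
    refine exists_congr fun i => ?_
    have hlast : Fin.last d ≠ i.castSucc := (Fin.castSucc_lt_last i).ne'
    simp [funext_iff, Fin.forall_fin_succ', Fin.init, Pi.single_apply, hlast,
      CharTwo.add_eq_zero]

/-- For `n ≥ 2`, the power graph of the path `P_n` has exactly two connected
components, each isomorphic to the hypercube `Q_{n-1}`. -/
theorem powerGraph_path (n : ℕ) (hn : 2 ≤ n) :
    ∃ C₁ C₂ : (powerGraph (pathGraph n)).ConnectedComponent,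
      C₁ ≠ C₂ ∧ (∀ C, C = C₁ ∨ C = C₂) ∧
      ∀ C : (powerGraph (pathGraph n)).ConnectedComponent,
        Nonempty (((powerGraph (pathGraph n)).induce C.supp) ≃g hypercube (n - 1)) := by
  obtain ⟨d, rfl⟩ := Nat.exists_eq_add_of_le' (one_le_two.trans hn)
  let e := powerGraphPathGraphIso d
  have hC (A B : Set (Fin (d + 1))) :
      (powerGraph (pathGraph (d + 1))).connectedComponentMk A =
        (powerGraph (pathGraph (d + 1))).connectedComponentMk B ↔ (e A).2 = (e B).2 := by
    rw [ConnectedComponent.eq, ← e.reachable_iff, reachable_boxProd, reachable_bot]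
    exact and_iff_right (hypercube_preconnected d _ _)
  refine ⟨connectedComponentMk _ (e.symm (0, 0)), connectedComponentMk _ (e.symm (0, 1)), ?_, ?_,
    nonempty_induce_supp_iso_of_iso_boxProd_bot (hypercube_preconnected d) e⟩
  · simp [hC]
  · intro C
    induction C using ConnectedComponent.ind with | _ A => ?_
    simp only [hC, RelIso.apply_symm_apply]
    generalize (e A).2 = p
    decide +revert
end

section
/- Let f : PC_6 → PC_4 be a graph homomorphism and let x be a vertex of PC_4 with |f⁻¹(x)| ≥ 5. Then there exists a vertex y of PC_4 adjacent to x with |f⁻¹(y)| ≥ 5; moreover, there exist adjacent vertices a and b of PC_6 such that f⁻¹(x) ⊆ N(a) and f⁻¹(y) ⊆ N(b). -/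
open SimpleGraph

/-- `v` belongs to the connection set of the projective cube of dimension `d`. -/
def IsProjGen {d : ℕ} (v : Fin d → ZMod 2) : Prop := hammingNorm v = 1 ∨ hammingNorm v = d

/-- `v` is the sum of two distinct elements of the connection set of `projCube 6`. -/
def IsProjGenPair (v : Fin 6 → ZMod 2) : Prop := hammingNorm v = 2 ∨ hammingNorm v = 5

instance {d : ℕ} : DecidablePred (IsProjGen (d := d)) := fun v => by
  unfold IsProjGen; infer_instance

instance : DecidablePred IsProjGenPair := fun v => by
  unfold IsProjGenPair; infer_instance

lemma vec_add_self {d : ℕ} (v : Fin d → ZMod 2) : v + v = 0 :=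
  funext fun i => CharTwo.add_self_eq_zero (v i)

lemma vec_add_add_cancel {d : ℕ} (u v : Fin d → ZMod 2) : u + v + v = u := by
  rw [add_assoc, vec_add_self, add_zero]

lemma vec_add_add_add_cancel {d : ℕ} (u v w : Fin d → ZMod 2) :
    (u + w) + (v + w) = u + v := by
  rw [add_add_add_comm, vec_add_self, add_zero]

lemma isProjGen_four_iff : ∀ v : Fin 4 → ZMod 2,
    ((∃ i, v = Pi.single i 1) ∨ v = fun _ => 1) ↔ IsProjGen v := by decide +kernel

lemma isProjGen_six_iff : ∀ v : Fin 6 → ZMod 2,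
    ((∃ i, v = Pi.single i 1) ∨ v = fun _ => 1) ↔ IsProjGen v := by decide +kernel

lemma projCube_adj_of_iff {d : ℕ} (hd : 0 < d)
    (h : ∀ v : Fin d → ZMod 2, ((∃ i, v = Pi.single i 1) ∨ v = fun _ => 1) ↔ IsProjGen v)
    (u v : Fin d → ZMod 2) : (projCube d).Adj u v ↔ IsProjGen (u + v) := by
  simp only [projCube, binCayley, SimpleGraph.fromRel_adj, Set.mem_union, Set.mem_ofPred_eq, h,
    add_comm v u, or_self, and_iff_right_iff_imp]
  rintro h' rfl
  rw [vec_add_self] at h'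
  simp [IsProjGen, hd.ne] at h'

lemma projCube_four_adj (u v : Fin 4 → ZMod 2) :
    (projCube 4).Adj u v ↔ IsProjGen (u + v) :=
  projCube_adj_of_iff (by norm_num) isProjGen_four_iff u v

lemma projCube_six_adj (u v : Fin 6 → ZMod 2) :
    (projCube 6).Adj u v ↔ IsProjGen (u + v) :=
  projCube_adj_of_iff (by norm_num) isProjGen_six_iff u v

lemma card_isProjGen_four :
    (Finset.univ.filter (IsProjGen (d := 4))).card = 5 := by decide +kernel

/-- `projCube 4` is triangle-free. -/
lemma IsProjGen.not_isProjGen_add : ∀ p : Fin 4 → ZMod 2, IsProjGen p →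
    ∀ q : Fin 4 → ZMod 2, IsProjGen q → ¬ IsProjGen (p + q) := by decide +kernel

/-- Two vertices of `projCube 6` are equal, have a common neighbor, or are joined by a walk of
length three. -/
lemma eq_zero_or_isProjGenPair_or : ∀ v : Fin 6 → ZMod 2, v = 0 ∨ IsProjGenPair v ∨
    ∃ p, IsProjGen p ∧ ∃ q, IsProjGen q ∧ IsProjGen (v + p + q) := by decide +kernel

set_option synthInstance.maxHeartbeats 400000 in
set_option synthInstance.maxSize 1000 in
/-- A triangle in the distance-two graph of `projCube 6` has a common neighbor `a`, and only one
vertex outside the neighborhood of `a` extends it to a clique of size four. -/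
lemma exists_common_neighbor_triangle : ∀ p : Fin 6 → ZMod 2, IsProjGenPair p →
    ∀ q : Fin 6 → ZMod 2, IsProjGenPair q → IsProjGenPair (p + q) →
    ∃ a : Fin 6 → ZMod 2, IsProjGen a ∧ IsProjGen (p + a) ∧ IsProjGen (q + a) ∧
      ∀ r : Fin 6 → ZMod 2, IsProjGenPair r → IsProjGenPair (r + p) → IsProjGenPair (r + q) →
        (IsProjGen (r + a) ∧ ¬ IsProjGenPair (r + (p + q))) ∨ r = p + q := by decide +kernel

lemma card_isProjGen_six : (Finset.univ.filter (IsProjGen (d := 6))).card = 7 := by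
  decide +kernel

lemma card_eq_zero_or_isProjGenPair :
    (Finset.univ.filter fun m : Fin 6 → ZMod 2 => m = 0 ∨ IsProjGenPair m).card = 22 := by
  decide +kernel

lemma IsProjGenPair.exists_isProjGen : ∀ m : Fin 6 → ZMod 2, IsProjGenPair m →
    ∃ u, IsProjGen u ∧ IsProjGen (m + u) := by decide +kernel

/-- Five neighbors of the origin of `projCube 6` have at least `21` neighbors in total. -/
lemma card_neighbors_ge (T : Finset (Fin 6 → ZMod 2)) (hT : ∀ t ∈ T, IsProjGen t)
    (hcard : T.card = 5) :
    21 ≤ (Finset.univ.filter fun m : Fin 6 → ZMod 2 => ∃ t ∈ T, IsProjGen (m + t)).card := by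
  have hsub : T ⊆ Finset.univ.filter (IsProjGen (d := 6)) := fun t ht => by simpa using hT t ht
  have h2 : (Finset.univ.filter (IsProjGen (d := 6)) \ T).card = 2 := by
    rw [Finset.card_sdiff_of_subset hsub, card_isProjGen_six, hcard]
  obtain ⟨p, q, -, hpq⟩ := Finset.card_eq_two.mp h2
  have hout : ∀ u, IsProjGen u → u ∉ T → u = p ∨ u = q := fun u hu huT => by
    have : u ∈ Finset.univ.filter (IsProjGen (d := 6)) \ T := by simp [hu, huT]
    simpa [hpq] using this
  have hle := Finset.pred_card_le_card_erase (a := p + q)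
    (s := Finset.univ.filter fun m : Fin 6 → ZMod 2 => m = 0 ∨ IsProjGenPair m)
  rw [card_eq_zero_or_isProjGenPair] at hle
  refine hle.trans (Finset.card_le_card fun m hm => ?_)
  obtain ⟨hne, hm⟩ := Finset.mem_erase.mp hm
  refine Finset.mem_filter.mpr ⟨Finset.mem_univ _, ?_⟩
  rcases (Finset.mem_filter.mp hm).2 with rfl | hm
  · obtain ⟨t, ht⟩ := Finset.card_pos.mp (by omega : 0 < T.card)
    exact ⟨t, ht, by simpa using hT t ht⟩
  · obtain ⟨u, hu, hmu⟩ := IsProjGenPair.exists_isProjGen m hm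
    by_contra! hc
    have hu' := hout u hu fun h => hc u h hmu
    have hmu' := hout (m + u) hmu fun h => hc _ h <| by
      rwa [← add_assoc, vec_add_self, zero_add]
    have hm0 : m ≠ 0 := by
      rintro rfl
      simp [IsProjGenPair] at hm
    have hm_eq := vec_add_add_cancel m u
    rcases hu' with rfl | rfl <;> rcases hmu' with h | h <;> rw [h] at hm_eq
    · exact hm0 (hm_eq.symm.trans (vec_add_self _))
    · exact hne (hm_eq.symm.trans (add_comm _ _))
    · exact hne hm_eq.symm
    · exact hm0 (hm_eq.symm.trans (vec_add_self _))

/-- A vertex not adjacent to the origin has at most four neighbors at distance zero or two from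
the origin. -/
lemma card_neighbors_le : ∀ b : Fin 6 → ZMod 2, ¬ IsProjGen b →
    (Finset.univ.filter fun m : Fin 6 → ZMod 2 =>
      (m = 0 ∨ IsProjGenPair m) ∧ IsProjGen (m + b)).card ≤ 4 := by decide +kernel

lemma IsProjGen.add_eq_zero_or_isProjGenPair : ∀ p : Fin 6 → ZMod 2, IsProjGen p →
    ∀ q : Fin 6 → ZMod 2, IsProjGen q → p + q = 0 ∨ IsProjGenPair (p + q) := by decide +kernel

lemma isProjGenPair_of_map_eq (f : projCube 6 →g projCube 4) {u v : Fin 6 → ZMod 2}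
    (h : f u = f v) (hne : u ≠ v) : IsProjGenPair (u + v) := by
  have key : ∀ s p, IsProjGen p → IsProjGen (f s + f (s + p)) := fun s p hp => by
    rw [← projCube_four_adj]
    apply f.map_adj
    rw [projCube_six_adj, ← add_assoc, vec_add_self, zero_add]
    exact hp
  rcases eq_zero_or_isProjGenPair_or (u + v) with h0 | h0 | ⟨p, hp, q, hq, hr⟩
  · exact absurd (by rw [← vec_add_add_cancel u v, h0, zero_add]) hne
  · exact h0
  · have h1 := key u p hp
    have h2 := key (u + p) q hq
    have h3 := key (u + p + q) _ hr
    have e : u + p + q + (u + v + p + q) = v := by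
      rw [show u + p + q + (u + v + p + q) = v + (u + u) + (p + p) + (q + q) by abel]
      simp [vec_add_self]
    rw [e, ← h] at h3
    refine absurd ?_ (IsProjGen.not_isProjGen_add _ h1 _ h2)
    rw [show f u + f (u + p) + (f (u + p) + f (u + p + q))
      = f (u + p + q) + f u + (f (u + p) + f (u + p)) by abel, vec_add_self, add_zero]
    exact h3

/-- Five or more vertices of `projCube 6` pairwise at distance two have a common neighbor. -/
lemma exists_common_neighbor (S : Finset (Fin 6 → ZMod 2)) (hS : 5 ≤ S.card)
    (h : ∀ u ∈ S, ∀ v ∈ S, u ≠ v → IsProjGenPair (u + v)) :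
    ∃ a, ∀ u ∈ S, IsProjGen (u + a) := by
  obtain ⟨o, ho, p, hp, q, hq, hop, hoq, hpq⟩ := Finset.two_lt_card.mp (by omega : 2 < S.card)
  obtain ⟨a, ha, hpa, hqa, hr⟩ := exists_common_neighbor_triangle (p + o) (h p hp o ho hop.symm)
    (q + o) (h q hq o ho hoq.symm) (by rw [vec_add_add_add_cancel]; exact h p hp q hq hpq)
  have hr' : ∀ r ∈ S, r ≠ o → r ≠ p → r ≠ q →
      (IsProjGen (r + (o + a)) ∧ ¬ IsProjGenPair (r + (o + p + q))) ∨ r = o + p + q := by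
    intro r hrS h1 h2 h3
    rcases hr (r + o) (h r hrS o ho h1)
      (by rw [vec_add_add_add_cancel]; exact h r hrS p hp h2)
      (by rw [vec_add_add_add_cancel]; exact h r hrS q hq h3) with h4 | h4
    · left
      rw [vec_add_add_add_cancel] at h4
      rwa [← add_assoc, show r + (o + p + q) = r + o + (p + q) by abel]
    · right
      rw [vec_add_add_add_cancel] at h4
      rw [← vec_add_add_cancel r o, h4]
      abel
  refine ⟨o + a, fun r hrS => ?_⟩
  by_cases h1 : r = o
  · rwa [h1, ← add_assoc, vec_add_self, zero_add]
  by_cases h2 : r = p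
  · rwa [h2, ← add_assoc]
  by_cases h3 : r = q
  · rwa [h3, ← add_assoc]
  rcases hr' r hrS h1 h2 h3 with h4 | h4
  · exact h4.1
  have hcard : 0 < (S \ {o, p, q, r}).card := by
    have := Finset.le_card_sdiff {o, p, q, r} S
    have := Finset.card_le_four (a := o) (b := p) (c := q) (d := r)
    omega
  obtain ⟨s, hs⟩ := Finset.card_pos.mp hcard
  simp only [Finset.mem_sdiff, Finset.mem_insert, Finset.mem_singleton, not_or] at hs
  obtain ⟨hsS, so, sp, sq, sr⟩ := hs
  rcases hr' s hsS so sp sq with h5 | h5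
  · rw [← h4] at h5
    exact absurd (h s hsS r hrS sr) h5.2
  · exact absurd (h5.trans h4.symm) sr

lemma exists_common_neighbor_preimage (f : projCube 6 →g projCube 4) (x : Fin 4 → ZMod 2)
    (hx : 5 ≤ (⇑f ⁻¹' {x}).ncard) : ∃ a, ∀ u, f u = x → IsProjGen (u + a) := by
  classical
  rw [Set.ncard_eq_toFinset_card'] at hx
  obtain ⟨a, ha⟩ := exists_common_neighbor _ hx fun u hu v hv hne => by
    simp only [Set.mem_toFinset, Set.mem_preimage, Set.mem_singleton_iff] at hu hv
    exact isProjGenPair_of_map_eq f (hu.trans hv.symm) hne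
  exact ⟨a, fun u hu => ha u (by simpa using hu)⟩

/-- Let `f : PC_6 → PC_4` be a homomorphism and `x` a vertex of `PC_4` with at
least `5` pre-images.  Then some neighbor `y` of `x` also has at least `5`
pre-images, and the common neighbor `a` of the pre-image of `x` is adjacent to
the common neighbor `b` of the pre-image of `y`. -/
theorem projCube_hom_five_gives_five
    (f : projCube 6 →g projCube 4)
    (x : Fin 4 → ZMod 2) (hx : 5 ≤ (⇑f ⁻¹' {x}).ncard) :
    ∃ y : Fin 4 → ZMod 2, (projCube 4).Adj x y ∧ 5 ≤ (⇑f ⁻¹' {y}).ncard ∧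
      ∃ a b : Fin 6 → ZMod 2, (projCube 6).Adj a b ∧
        ⇑f ⁻¹' {x} ⊆ (projCube 6).neighborSet a ∧
        ⇑f ⁻¹' {y} ⊆ (projCube 6).neighborSet b := by
  classical
  obtain ⟨a, ha⟩ := exists_common_neighbor_preimage f x hx
  rw [Set.ncard_eq_toFinset_card'] at hx
  obtain ⟨F, hF, hF5⟩ := Finset.exists_subset_card_eq hx
  have hFx : ∀ u ∈ F, f u = x := fun u hu => by simpa using hF hu
  set T := F.image (· + a) with hT
  set M := Finset.univ.filter fun m : Fin 6 → ZMod 2 => ∃ t ∈ T, IsProjGen (m + t)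
  have hTgen : ∀ t ∈ T, IsProjGen t := by
    simp only [hT, Finset.mem_image]
    rintro _ ⟨u, hu, rfl⟩
    exact ha u (hFx u hu)
  have hM21 : 21 ≤ M.card := card_neighbors_ge T hTgen <| by
    rw [hT, Finset.card_image_of_injective _ (add_left_injective a), hF5]
  have hmaps : ∀ m ∈ M, x + f (m + a) ∈ Finset.univ.filter (IsProjGen (d := 4)) := by
    intro m hm
    obtain ⟨t, ht, hmt⟩ := (Finset.mem_filter.mp hm).2
    obtain ⟨u, hu, rfl⟩ := Finset.mem_image.mp ht
    rw [Finset.mem_filter, ← projCube_four_adj, ← hFx u hu]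
    refine ⟨Finset.mem_univ _, f.map_adj ?_⟩
    rw [projCube_six_adj]
    convert hmt using 1
    abel
  obtain ⟨z, hz, hcard⟩ := Finset.exists_lt_card_fiber_of_mul_lt_card_of_maps_to (n := 4) hmaps
    (by rw [card_isProjGen_four]; omega)
  have hxz : ∀ m, x + f (m + a) = z → f (m + a) = x + z := by
    rintro m rfl
    rw [← add_assoc, vec_add_self, zero_add]
  have hy : 5 ≤ (⇑f ⁻¹' {x + z}).ncard := by
    rw [Set.ncard_eq_toFinset_card']
    refine hcard.trans_le (Finset.card_le_card_of_injOn (· + a) (fun m hm => ?_)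
      (add_left_injective a).injOn)
    simpa using hxz m (Finset.mem_filter.mp hm).2
  obtain ⟨b, hb⟩ := exists_common_neighbor_preimage f (x + z) hy
  refine ⟨x + z, ?_, hy, a, b, ?_, fun u hu => ?_, fun u hu => ?_⟩
  · rw [projCube_four_adj, ← add_assoc, vec_add_self, zero_add]
    exact (Finset.mem_filter.mp hz).2
  · rw [projCube_six_adj]
    by_contra hab
    refine (hcard.trans_le (Finset.card_le_card fun m hm => ?_)).not_ge (card_neighbors_le _ hab)
    obtain ⟨hmM, hmz⟩ := Finset.mem_filter.mp hm
    obtain ⟨t, ht, hmt⟩ := (Finset.mem_filter.mp hmM).2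
    refine Finset.mem_filter.mpr ⟨Finset.mem_univ _, ?_, ?_⟩
    · rw [← vec_add_add_cancel m t]
      exact IsProjGen.add_eq_zero_or_isProjGenPair _ hmt _ (hTgen t ht)
    · rw [← add_assoc]
      exact hb _ (hxz m hmz)
  · rw [SimpleGraph.mem_neighborSet, projCube_six_adj, add_comm]
    exact ha u hu
  · rw [SimpleGraph.mem_neighborSet, projCube_six_adj, add_comm]
    exact hb u hu
end

section
/- Every graph homomorphism from the projective cube PC_6 to the projective cube PC_4 is surjective. -/
open SimpleGraph

/-- A `k`-dimensional face of the cube `(ℤ/2ℤ)^m`, described coordinate by coordinate as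
fixed to a value or free. -/
inductive CubeFace : ℕ → ℕ → Type
  | nil : CubeFace 0 0
  | fix {m k : ℕ} (b : ZMod 2) (w : CubeFace m k) : CubeFace (m + 1) k
  | free {m k : ℕ} (w : CubeFace m k) : CubeFace (m + 1) (k + 1)

namespace CubeFace

/-- The vertices of the cube lying on a face. -/
def verts : {m k : ℕ} → CubeFace m k → Set (Fin m → ZMod 2)
  | _, _, nil => Set.univ
  | _, _, fix b w => {v | v 0 = b ∧ Fin.tail v ∈ w.verts}
  | _, _, free w => {v | Fin.tail v ∈ w.verts}

/-- The vertex of a face whose free coordinates are all `0`. -/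
def base : {m k : ℕ} → CubeFace m k → Fin m → ZMod 2
  | _, _, nil => 0
  | _, _, fix b w => Fin.cons b w.base
  | _, _, free w => Fin.cons 0 w.base

/-- The image of a face under the antipodal map `v ↦ v + 1`. -/
def antipode : {m k : ℕ} → CubeFace m k → CubeFace m k
  | _, _, nil => nil
  | _, _, fix b w => fix (b + 1) w.antipode
  | _, _, free w => free w.antipode

/-- `IsFacet c w` says that `c` is a codimension one face of `w`. -/
inductive IsFacet : {m k : ℕ} → CubeFace m k → CubeFace m (k + 1) → Prop
  | here {m k : ℕ} (b : ZMod 2) (w : CubeFace m k) : IsFacet (fix b w) (free w)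
  | fix {m k : ℕ} (b : ZMod 2) {c : CubeFace m k} {w : CubeFace m (k + 1)} :
      IsFacet c w → IsFacet (fix b c) (fix b w)
  | free {m k : ℕ} {c : CubeFace m k} {w : CubeFace m (k + 1)} :
      IsFacet c w → IsFacet (free c) (free w)

/-- The cubical coboundary operator modulo 2. -/
def coboundary : {m k : ℕ} → (CubeFace m k → ZMod 2) → CubeFace m (k + 1) → ZMod 2
  | _, _, φ, fix b w => coboundary (fun c => φ (fix b c)) w
  | _, 0, φ, free w => φ (fix 0 w) + φ (fix 1 w)
  | _, _ + 1, φ, free w => φ (fix 0 w) + φ (fix 1 w) + coboundary (fun c => φ (free c)) w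

/-- Evaluation of a cochain on a `k`-dimensional hemisphere: the sum over all faces
whose fixed coordinates form alternating blocks of `0` and `1`, starting with `0`. -/
def hemisphere : (m k : ℕ) → (CubeFace m k → ZMod 2) → ZMod 2
  | 0, 0, φ => φ nil
  | 0, _ + 1, _ => 0
  | m + 1, 0, φ => hemisphere m 0 fun c => φ (fix 0 c)
  | m + 1, k + 1, φ =>
      hemisphere m (k + 1) (fun c => φ (fix 0 c)) + hemisphere m k fun c => φ (free c.antipode)

theorem zmod_two_add_one_add_one (b : ZMod 2) : b + 1 + 1 = b := by
  revert b; decide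

theorem base_mem {m k : ℕ} (w : CubeFace m k) : w.base ∈ w.verts := by
  induction w with
  | nil => trivial
  | fix b w ih => exact ⟨rfl, by simpa [base] using ih⟩
  | free w ih => simpa [base, verts] using ih

theorem mem_verts_antipode {m k : ℕ} (w : CubeFace m k) (v : Fin m → ZMod 2) :
    v ∈ w.antipode.verts ↔ v + 1 ∈ w.verts := by
  induction w with
  | nil => simp [verts, antipode]
  | fix b w ih =>
    have h : v 0 = b + 1 ↔ v 0 + 1 = b := by
      generalize v 0 = a
      revert a b; decide
    simp only [antipode, verts, Set.mem_ofPred_eq, ih, Pi.add_apply, Pi.one_apply, h]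
    rfl
  | free w ih =>
    simp only [antipode, verts, Set.mem_ofPred_eq, ih]
    rfl

theorem antipode_antipode {m k : ℕ} (w : CubeFace m k) : w.antipode.antipode = w := by
  induction w with
  | nil => rfl
  | fix b w ih => simp [antipode, ih, zmod_two_add_one_add_one]
  | free w ih => simp [antipode, ih]

theorem IsFacet.verts_subset {m k : ℕ} {c : CubeFace m k} {w : CubeFace m (k + 1)}
    (h : IsFacet c w) : c.verts ⊆ w.verts := by
  induction h with
  | here b w => exact fun v hv => hv.2
  | fix b _ ih => exact fun v hv => ⟨hv.1, ih hv.2⟩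
  | free _ ih => exact fun v hv => ih hv

theorem cons_add_single {m : ℕ} (b : ZMod 2) (v : Fin m → ZMod 2) (j : Fin m) :
    (Fin.cons b (v + Pi.single j 1) : Fin (m + 1) → ZMod 2) =
      Fin.cons b v + Pi.single j.succ 1 := by
  ext i
  refine Fin.cases ?_ (fun i => ?_) i
  · simp
  · simp [Pi.single_apply]

/-- Two facets of a face either meet or are opposite. -/
theorem IsFacet.meet_or_opposite {m k : ℕ} {c c' : CubeFace m k} {w : CubeFace m (k + 1)}
    (h : IsFacet c w) (h' : IsFacet c' w) :
    (∃ v, v ∈ c.verts ∧ v ∈ c'.verts) ∨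
      (w.verts ⊆ c.verts ∪ c'.verts ∧ ∃ v ∈ c.verts, ∃ j, v + Pi.single j 1 ∈ c'.verts) := by
  induction h with
  | here b w =>
    cases h' with
    | here b' =>
      by_cases hb : b = b'
      · subst hb
        exact Or.inl ⟨_, base_mem _, base_mem _⟩
      · have hc : ∀ x : ZMod 2, x = b ∨ x = b' := by
          revert b b'; decide
        have hb' : b + 1 = b' := by
          revert b b'; decide
        refine Or.inr ⟨fun v hv => (hc (v 0)).imp (fun e => ⟨e, hv⟩) fun e => ⟨e, hv⟩,
          _, base_mem _, 0, ?_, ?_⟩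
        · simpa [base] using hb'
        · have : Fin.tail ((CubeFace.fix b w).base + Pi.single 0 1) = w.base := by
            ext i
            simp [Fin.tail, base]
          rw [this]
          exact base_mem w
    | @free _ _ c' _ hc' =>
      refine Or.inl ⟨Fin.cons b c'.base, ⟨rfl, ?_⟩, ?_⟩
      · simpa using hc'.verts_subset (base_mem _)
      · simpa [verts] using base_mem c'
  | fix b _ ih =>
    cases h' with
    | fix _ h' =>
      rcases ih h' with ⟨v, hv, hv'⟩ | ⟨hw, v, hv, j, hj⟩
      · exact Or.inl ⟨Fin.cons b v, by simpa [verts] using hv, by simpa [verts] using hv'⟩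
      · refine Or.inr ⟨fun v hv => (hw hv.2).imp (fun e => ⟨hv.1, e⟩) fun e => ⟨hv.1, e⟩,
          Fin.cons b v, by simpa [verts] using hv, j.succ, ?_⟩
        rw [← cons_add_single]
        simpa [verts] using hj
  | @free _ _ c w hc ih =>
    cases h' with
    | here b' =>
      refine Or.inl ⟨Fin.cons b' c.base, ?_, rfl, ?_⟩
      · simpa [verts] using base_mem c
      · simpa using hc.verts_subset (base_mem _)
    | free h' =>
      rcases ih h' with ⟨v, hv, hv'⟩ | ⟨hw, v, hv, j, hj⟩
      · exact Or.inl ⟨Fin.cons 0 v, by simpa [verts] using hv, by simpa [verts] using hv'⟩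
      · refine Or.inr ⟨fun v hv => hw hv, Fin.cons 0 v, by simpa [verts] using hv, j.succ, ?_⟩
        rw [← cons_add_single]
        simpa [verts] using hj

theorem exists_isFacet_of_coboundary_ne_zero {m k : ℕ} {φ : CubeFace m k → ZMod 2}
    {w : CubeFace m (k + 1)} (h : coboundary φ w ≠ 0) : ∃ c, IsFacet c w ∧ φ c ≠ 0 := by
  induction m generalizing k with
  | zero => cases w
  | succ m ih =>
    cases w with
    | fix b w =>
      obtain ⟨c, hc, h⟩ := ih (φ := fun c => φ (fix b c)) (w := w) (by simpa [coboundary] using h)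
      exact ⟨_, hc.fix b, h⟩
    | free w =>
      by_contra! H
      apply h
      have h0 := H _ (IsFacet.here 0 w)
      have h1 := H _ (IsFacet.here 1 w)
      cases k with
      | zero => simp [coboundary, h0, h1]
      | succ k =>
        simp only [coboundary, h0, h1, zero_add]
        by_contra h2
        obtain ⟨c, hc, h3⟩ := ih h2
        exact h3 (H _ hc.free)

theorem coboundary_add {m k : ℕ} (φ ψ : CubeFace m k → ZMod 2) :
    coboundary (fun c => φ c + ψ c) = fun w => coboundary φ w + coboundary ψ w := by
  funext w
  induction m generalizing k with
  | zero => cases w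
  | succ m ih =>
    cases w with
    | fix b w => simp only [coboundary, ih]
    | free w =>
      cases k with
      | zero => simp only [coboundary]; ring
      | succ k => simp only [coboundary, ih]; ring

theorem coboundary_coboundary {m k : ℕ} (φ : CubeFace m k → ZMod 2) (w : CubeFace m (k + 2)) :
    coboundary (coboundary φ) w = 0 := by
  induction m generalizing k with
  | zero => cases w
  | succ m ih =>
    cases w with
    | fix b w => simpa only [coboundary] using ih _ w
    | free w =>
      cases k with
      | zero =>
        simp only [coboundary, coboundary_add]
        generalize coboundary _ w = x
        generalize coboundary _ w = y
        revert x y; decide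
      | succ k =>
        simp only [coboundary, coboundary_add, ih]
        generalize coboundary _ w = x
        generalize coboundary _ w = y
        revert x y; decide

theorem coboundary_one {m : ℕ} (w : CubeFace m 1) : coboundary (fun _ => 1) w = 0 := by
  induction m with
  | zero => cases w
  | succ m ih =>
    cases w with
    | fix b w => simpa only [coboundary] using ih w
    | free w => simp only [coboundary]; decide

theorem coboundary_antipode {m k : ℕ} (φ : CubeFace m k → ZMod 2) (w : CubeFace m (k + 1)) :
    coboundary φ w.antipode = coboundary (fun c => φ c.antipode) w := by
  induction m generalizing k with
  | zero => cases w
  | succ m ih =>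
    cases w with
    | fix b w => simp only [coboundary, antipode, ih]
    | free w =>
      have h : (1 : ZMod 2) + 1 = 0 := by decide
      cases k with
      | zero => simp only [coboundary, antipode, zero_add, h]; ring
      | succ k => simp only [coboundary, antipode, zero_add, h, ih]; ring

theorem hemisphere_add {m k : ℕ} (φ ψ : CubeFace m k → ZMod 2) :
    hemisphere m k (fun c => φ c + ψ c) = hemisphere m k φ + hemisphere m k ψ := by
  induction m generalizing k with
  | zero => cases k <;> simp [hemisphere]
  | succ m ih =>
    cases k with
    | zero => simp only [hemisphere, ih]
    | succ k => simp only [hemisphere, ih]; ring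

theorem hemisphere_zero_cochain {m k : ℕ} : hemisphere m k (fun _ => 0) = 0 := by
  induction m generalizing k with
  | zero => cases k <;> simp [hemisphere]
  | succ m ih => cases k <;> simp [hemisphere, ih]

theorem hemisphere_one {m : ℕ} : hemisphere m 0 (fun _ => 1) = 1 := by
  induction m with
  | zero => rfl
  | succ m ih => simpa only [hemisphere] using ih

/-- The boundary of a hemisphere is the union of two antipodal hemispheres. -/
theorem hemisphere_coboundary {m k : ℕ} (φ : CubeFace m k → ZMod 2) :
    hemisphere m (k + 1) (coboundary φ) =
      hemisphere m k φ + hemisphere m k fun c => φ c.antipode := by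
  have key : ∀ x y z : ZMod 2, x + y + (y + z) = x + z := by decide
  have key' : ∀ x y z s t : ZMod 2, x + y + (y + z + (s + t)) = x + s + (z + t) := by decide
  induction m generalizing k with
  | zero =>
    cases k with
    | zero =>
      simp only [hemisphere, antipode]
      generalize φ nil = x
      revert x; decide
    | succ k => simp [hemisphere]
  | succ m ih =>
    cases k with
    | zero => simp only [hemisphere, coboundary, hemisphere_add, ih, antipode, zero_add, key]
    | succ k =>
      simp only [hemisphere, coboundary, hemisphere_add, ih, antipode, zero_add,
        coboundary_antipode, antipode_antipode]
      exact key' _ _ _ _ _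

variable {m : ℕ}

/-- The cochain counting the `k`-faces mapped by `F` isomorphically onto a face in the directions
of the first `k` coordinates. -/
def degreeCochain (F : (Fin m → ZMod 2) → ℕ → ZMod 2) : (k : ℕ) → CubeFace m k → ZMod 2
  | 0 => fun _ => 1
  | k + 1 => coboundary fun c => degreeCochain F k c * F c.base k

theorem coboundary_degreeCochain (F : (Fin m → ZMod 2) → ℕ → ZMod 2) (k : ℕ)
    (w : CubeFace m (k + 1)) : coboundary (degreeCochain F k) w = 0 := by
  cases k with
  | zero => exact coboundary_one w
  | succ k => exact coboundary_coboundary _ w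

theorem degreeCochain_ne_zero {F : (Fin m → ZMod 2) → ℕ → ZMod 2}
    (hF : ∀ v j, ∃ l, ∀ i, i ≠ l → F (v + Pi.single j 1) i = F v i) {k : ℕ}
    {w : CubeFace m k} (hw : degreeCochain F k w ≠ 0) :
    (∀ v ∈ w.verts, ∀ v' ∈ w.verts, ∀ i, k ≤ i → F v i = F v' i) ∧
      ∀ y : ℕ → ZMod 2, ∃ v ∈ w.verts, ∀ i < k, F v i = y i := by
  induction k with
  | zero =>
    refine ⟨fun v hv v' hv' i _ => ?_, fun y => ⟨_, base_mem w, fun i hi => by omega⟩⟩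
    suffices h : ∀ {n : ℕ} (w : CubeFace n 0), ∀ v ∈ w.verts, ∀ v' ∈ w.verts, v = v' by
      rw [h w v hv v' hv']
    intro n w
    induction n with
    | zero => exact fun v _ v' _ => Subsingleton.elim v v'
    | succ n ih =>
      cases w with
      | fix b w =>
        intro v hv v' hv'
        rw [← Fin.cons_self_tail v, ← Fin.cons_self_tail v', ih w _ hv.2 _ hv'.2, hv.1, hv'.1]
  | succ k ih =>
    have hw' : coboundary (fun c => degreeCochain F k c * F c.base k + degreeCochain F k c) w ≠ 0 := by
      rw [coboundary_add]
      simp only [coboundary_degreeCochain, add_zero]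
      exact hw
    obtain ⟨c, hc, h1⟩ := exists_isFacet_of_coboundary_ne_zero hw
    obtain ⟨c', hc', h2⟩ := exists_isFacet_of_coboundary_ne_zero hw'
    have split : ∀ x y : ZMod 2, (x * y ≠ 0 → x ≠ 0 ∧ y = 1) ∧
      (x * y + x ≠ 0 → x ≠ 0 ∧ y = 0) := by decide
    obtain ⟨d, e⟩ := (split _ _).1 h1
    obtain ⟨d', e'⟩ := (split _ _).2 h2
    obtain ⟨const, surj⟩ := ih d
    obtain ⟨const', surj'⟩ := ih d'
    have val : ∀ v ∈ c.verts, F v k = 1 := fun v hv =>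
      (const v hv _ (base_mem c) k le_rfl).trans e
    have val' : ∀ v ∈ c'.verts, F v k = 0 := fun v hv =>
      (const' v hv _ (base_mem c') k le_rfl).trans e'
    rcases hc.meet_or_opposite hc' with ⟨v, hv, hv'⟩ | ⟨cover, v, hv, j, hj⟩
    · exact absurd ((val v hv).symm.trans (val' v hv')) (by decide)
    · have edge : ∀ i, k + 1 ≤ i → F (v + Pi.single j 1) i = F v i := by
        obtain ⟨l, hl⟩ := hF v j
        have hkl : k = l := by
          by_contra hne
          have := hl k hne
          rw [val v hv, val' _ hj] at this
          exact absurd this (by decide)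
        exact fun i hi => hl i (by omega)
      have all : ∀ u ∈ w.verts, ∀ i, k + 1 ≤ i → F u i = F v i := by
        intro u hu i hi
        rcases cover hu with hu | hu
        · exact const u hu v hv i (by omega)
        · exact (const' u hu _ hj i (by omega)).trans (edge i hi)
      refine ⟨fun u hu u' hu' i hi => (all u hu i hi).trans (all u' hu' i hi).symm, fun y => ?_⟩
      have hy : y k = 1 ∨ y k = 0 := by
        generalize y k = x
        revert x; decide
      rcases hy with hy | hy
      · obtain ⟨u, hu, h⟩ := surj y
        refine ⟨u, hc.verts_subset hu, fun i hi => ?_⟩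
        rcases Nat.lt_succ_iff_lt_or_eq.1 hi with hi | rfl
        · exact h i hi
        · rw [val u hu, hy]
      · obtain ⟨u, hu, h⟩ := surj' y
        refine ⟨u, hc'.verts_subset hu, fun i hi => ?_⟩
        rcases Nat.lt_succ_iff_lt_or_eq.1 hi with hi | rfl
        · exact h i hi
        · rw [val' u hu, hy]

theorem degreeCochain_mul_antipode {F : (Fin m → ZMod 2) → ℕ → ZMod 2}
    (hF : ∀ v j, ∃ l, ∀ i, i ≠ l → F (v + Pi.single j 1) i = F v i) {k : ℕ}
    (hT : ∀ v, F (v + 1) k = F v k + 1)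
    (hD : ∀ w : CubeFace m k, degreeCochain F k w.antipode = degreeCochain F k w)
    (w : CubeFace m k) :
    degreeCochain F k w.antipode * F w.antipode.base k =
      degreeCochain F k w * F w.base k + degreeCochain F k w := by
  rw [hD]
  by_cases h : degreeCochain F k w = 0
  · simp [h]
  · have h1 := (degreeCochain_ne_zero hF h).1 _ ((mem_verts_antipode w _).1 (base_mem _)) _
      (base_mem w) k le_rfl
    rw [← h1, hT]
    generalize F w.antipode.base k = x
    generalize degreeCochain F k w = y
    revert x y; decide

theorem degreeCochain_antipode {F : (Fin m → ZMod 2) → ℕ → ZMod 2}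
    (hF : ∀ v j, ∃ l, ∀ i, i ≠ l → F (v + Pi.single j 1) i = F v i) {k : ℕ}
    (hT : ∀ v, ∀ i < k, F (v + 1) i = F v i + 1) (w : CubeFace m k) :
    degreeCochain F k w.antipode = degreeCochain F k w := by
  induction k with
  | zero => rfl
  | succ k ih =>
    have h := degreeCochain_mul_antipode hF (fun v => hT v k k.lt_succ_self)
      (ih fun v i hi => hT v i (by omega))
    simp only [degreeCochain, coboundary_antipode, h, coboundary_add, coboundary_degreeCochain,
      add_zero]

theorem hemisphere_degreeCochain {F : (Fin m → ZMod 2) → ℕ → ZMod 2}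
    (hF : ∀ v j, ∃ l, ∀ i, i ≠ l → F (v + Pi.single j 1) i = F v i) {k : ℕ}
    (hT : ∀ v, ∀ i < k, F (v + 1) i = F v i + 1) :
    hemisphere m k (degreeCochain F k) = 1 := by
  induction k with
  | zero => exact hemisphere_one
  | succ k ih =>
    have hT' : ∀ v, ∀ i < k, F (v + 1) i = F v i + 1 := fun v i hi => hT v i (by omega)
    have h := degreeCochain_mul_antipode hF (fun v => hT v k k.lt_succ_self)
      (degreeCochain_antipode hF hT')
    have key : ∀ x y : ZMod 2, x + (x + y) = y := by decide
    simp only [degreeCochain, hemisphere_coboundary, h, hemisphere_add, key]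
    exact ih hT'

/-- An antipodal map between cubes that changes at most one coordinate along each edge
attains a constant vector. -/
theorem exists_const_of_antipodal {F : (Fin m → ZMod 2) → ℕ → ZMod 2}
    (hF : ∀ v j, ∃ l, ∀ i, i ≠ l → F (v + Pi.single j 1) i = F v i) (n : ℕ)
    (hT : ∀ v, ∀ i < n, F (v + 1) i = F v i + 1) : ∃ v, ∀ i < n, F v i = F v n := by
  have h : ∃ w, degreeCochain F n w ≠ 0 := by
    by_contra! H
    have h1 := hemisphere_degreeCochain hF hT
    rw [show degreeCochain F n = fun _ => 0 from funext H, hemisphere_zero_cochain] at h1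
    exact absurd h1 (by decide)
  obtain ⟨w, hw⟩ := h
  obtain ⟨const, surj⟩ := degreeCochain_ne_zero hF hw
  obtain ⟨v, hv, h⟩ := surj fun _ => F w.base n
  exact ⟨v, fun i hi => (h i hi).trans (const _ (base_mem w) v hv n le_rfl)⟩

end CubeFace

theorem projCube_adj_iff {d : ℕ} {u v : Fin d → ZMod 2} :
    (projCube d).Adj u v ↔
      u ≠ v ∧ ((∃ i, v = u + Pi.single i 1) ∨ v = u + 1) := by
  have key : ∀ x : Fin d → ZMod 2, u + v = x ↔ v = u + x := by
    intro x
    have h : ∀ a b c : ZMod 2, a + b = c ↔ b = a + c := by decide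
    simp only [funext_iff, Pi.add_apply, h]
  have hone : (fun _ => 1 : Fin d → ZMod 2) = 1 := rfl
  simp only [projCube, binCayley, SimpleGraph.fromRel_adj, add_comm v u, or_self,
    Set.mem_union, Set.mem_ofPred_eq, key, hone]

/-- The quotient of the cube of dimension 7 by its antipodal map. -/
def cubeToProj (v : Fin 7 → ZMod 2) : Fin 6 → ZMod 2 :=
  fun i => v i.castSucc + v (Fin.last 6)

theorem cubeToProj_adj (v : Fin 7 → ZMod 2) (j : Fin 7) :
    (projCube 6).Adj (cubeToProj v) (cubeToProj (v + Pi.single j 1)) := by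
  rw [projCube_adj_iff]
  refine Fin.lastCases ?_ (fun j => ?_) j
  · have h : cubeToProj (v + Pi.single (Fin.last 6) 1) = cubeToProj v + 1 := by
      ext i
      simp only [cubeToProj, Pi.add_apply, Pi.single_apply, Fin.castSucc_ne_last, if_true, if_false,
        add_zero, Pi.one_apply, add_assoc]
    rw [h]
    exact ⟨fun e => by simpa using congrFun e 0, Or.inr rfl⟩
  · have h : cubeToProj (v + Pi.single j.castSucc 1) = cubeToProj v + Pi.single j 1 := by
      ext i
      simp only [cubeToProj, Pi.add_apply, Pi.single_apply, (Fin.castSucc_ne_last _).symm, if_false,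
        add_zero, Fin.castSucc_inj, add_right_comm]
    rw [h]
    exact ⟨fun e => by simpa using congrFun e j, Or.inl ⟨j, rfl⟩⟩

theorem cubeToProj_add_one (v : Fin 7 → ZMod 2) : cubeToProj (v + 1) = cubeToProj v := by
  have key : ∀ a b : ZMod 2, a + 1 + (b + 1) = a + b := by decide
  ext i
  simp [cubeToProj, key]

/-- Every graph homomorphism from `PC_6` to `PC_4` is surjective. -/
theorem projCube_six_to_four_surjective (f : projCube 6 →g projCube 4) :
    Function.Surjective f := by
  intro t
  let s (v : Fin 7 → ZMod 2) : ZMod 2 := ∑ i, v i + ∑ i, (f (cubeToProj v) + t) i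
  let F (v : Fin 7 → ZMod 2) (i : ℕ) : ZMod 2 :=
    if h : i < 4 then (f (cubeToProj v) + t) ⟨i, h⟩ + s v else if i = 4 then s v else 0
  have two : (1 : ZMod 2) + 1 = 0 := by decide
  have hF : ∀ v j, ∃ l, ∀ i, i ≠ l → F (v + Pi.single j 1) i = F v i := by
    intro v j
    rcases (projCube_adj_iff.1 (f.map_adj (cubeToProj_adj v j))).2 with ⟨l, hl⟩ | hl
    · have hs : s (v + Pi.single j 1) = s v := by
        simp only [s, hl, Pi.add_apply, Finset.sum_add_distrib]
        simp
        linear_combination two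
      refine ⟨l, fun i hi => ?_⟩
      simp only [F, hs, hl]
      split_ifs with h
      · have : (⟨i, h⟩ : Fin 4) ≠ l := fun e => hi (by rw [← e])
        simp [this]
      · rfl
      · rfl
    · have hs : s (v + Pi.single j 1) = s v + 1 := by
        have four : (4 : ZMod 2) = 0 := by decide
        simp only [s, hl, Pi.add_apply, Finset.sum_add_distrib]
        simp [four]
        ring
      refine ⟨4, fun i hi => ?_⟩
      simp only [F, hs, hl]
      split_ifs with h
      · have key : ∀ a b c : ZMod 2, a + 1 + b + (c + 1) = a + b + c := by decide
        simp [key]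
      · rfl
  have hT : ∀ v, ∀ i < 4, F (v + 1) i = F v i + 1 := by
    intro v i hi
    have hs : s (v + 1) = s v + 1 := by
      have seven : (7 : ZMod 2) = 1 := by decide
      simp only [s, cubeToProj_add_one, Pi.add_apply, Finset.sum_add_distrib]
      simp [seven]
      ring
    simp only [F, hi, dif_pos, hs, cubeToProj_add_one, add_assoc]
  obtain ⟨v, hv⟩ := CubeFace.exists_const_of_antipodal hF 4 hT
  refine ⟨cubeToProj v, funext fun i => ?_⟩
  have h := hv i i.2
  have key : ∀ a b c : ZMod 2, a + b + c = c → a = b := by decide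
  simp only [F, i.2, dif_pos, lt_irrefl, dif_neg, not_false_eq_true, if_true] at h
  exact key _ _ _ h
end
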